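/- (Caccioppoli-type estimate) Let u be a weak solution of B_α u = V u in the gauge ball B_R, where |V(z,t)| ≤ C₀ ρ(z,t)^{δ-2} with C₀ > 1 and 0 < δ ≤ 2. Then for every r₀ with 4r₀ < R there is a constant C > 0 (depending on C₀, δ, and dimensions but not on r₀ or u) such that ∫_{{r₀ < ρ < 2r₀}} |Xu|² ≤ (C/r₀²) ∫_{B_{4r₀}} u². -/

import Mathlib

open MeasureTheory Real

noncomputable section

variable {m k : ℕ}

abbrev Pt (m k : ℕ) := EuclideanSpace ℝ (Fin m) × EuclideanSpace ℝ (Fin k)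

/-- standard basis direction in the `z` variables -/
def ez (i : Fin m) : Pt m k := (EuclideanSpace.single i (1:ℝ), 0)

/-- standard basis direction in the `t` variables -/
def et (j : Fin k) : Pt m k := (0, EuclideanSpace.single j (1:ℝ))

/-- second partial derivative in direction `v` -/
def pd2 (u : Pt m k → ℝ) (p v : Pt m k) : ℝ :=
  fderiv ℝ (fun q => fderiv ℝ u q v) p v

/-- Laplacian in the `z` variables -/
def lapz (u : Pt m k → ℝ) (p : Pt m k) : ℝ := ∑ i : Fin m, pd2 u p (ez i)

/-- Laplacian in the `t` variables -/
def lapt (u : Pt m k → ℝ) (p : Pt m k) : ℝ := ∑ j : Fin k, pd2 u p (et j)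

/-- the Baouendi operator `B_α u = Δ_z u + |z|^{2α} Δ_t u` -/
def Bop (α : ℝ) (u : Pt m k → ℝ) (p : Pt m k) : ℝ :=
  lapz u p + ‖p.1‖ ^ (2*α) * lapt u p

/-- the generator `Z = Σ z_i ∂_{z_i} + (α+1) Σ t_j ∂_{t_j}` -/
def Zop (α : ℝ) (u : Pt m k → ℝ) (p : Pt m k) : ℝ :=
  fderiv ℝ u p (p.1, (α+1) • p.2)

/-- the intrinsic gauge `ρ` -/
def rho (α : ℝ) (p : Pt m k) : ℝ :=
  (‖p.1‖ ^ (2*(α+1)) + (α+1)^2 * ‖p.2‖^2) ^ (1/(2*(α+1)))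

/-- the angle function `ψ = |z|^{2α}/ρ^{2α}` -/
def psi (α : ℝ) (p : Pt m k) : ℝ := ‖p.1‖ ^ (2*α) / rho α p ^ (2*α)

/-- `|∇_z u|²` -/
def gradzSq (u : Pt m k → ℝ) (p : Pt m k) : ℝ :=
  ∑ i : Fin m, (fderiv ℝ u p (ez i))^2

/-- `|∇_t u|²` -/
def gradtSq (u : Pt m k → ℝ) (p : Pt m k) : ℝ :=
  ∑ j : Fin k, (fderiv ℝ u p (et j))^2

/-- `|Xu|² = |∇_z u|² + |z|^{2α}|∇_t u|²` -/
def XgradSq (α : ℝ) (u : Pt m k → ℝ) (p : Pt m k) : ℝ :=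
  gradzSq u p + ‖p.1‖ ^ (2*α) * gradtSq u p

/-- anisotropic dilation `δ_λ(z,t) = (λz, λ^{α+1}t)` -/
def dil (α l : ℝ) (p : Pt m k) : Pt m k := (l • p.1, (l ^ (α+1)) • p.2)

/-- gauge ball `B_r` -/
def gball (α r : ℝ) : Set (Pt m k) := {p | rho α p < r}

open Filter Topology ENNReal in
theorem tendsto_eLpNorm_sub_translate {E : Type*} [NormedAddCommGroup E] [NormedSpace ℝ E]
    [FiniteDimensional ℝ E] [MeasurableSpace E] [BorelSpace E] (μ : Measure E) [μ.IsAddHaarMeasure]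
    {g : E → ℝ} (hg : MemLp g 2 μ) :
    Tendsto (fun y => eLpNorm (fun x => g (x - y) - g x) 2 μ) (𝓝 0) (𝓝 0) := by
  let T : E → C(E, E) := fun y => ⟨fun x => x - y, by fun_prop⟩
  have hT : Continuous T := by
    refine ContinuousMap.continuous_of_continuous_uncurry _ ?_
    change Continuous fun p : E × E => p.2 - p.1
    fun_prop
  have hm : ∀ y, MeasurePreserving (T y) μ μ := fun y => measurePreserving_sub_right μ y
  have : Fact ((1 : ℝ≥0∞) ≤ 2) := ⟨by norm_num⟩
  have h := (continuous_const (y := hg.toLp g)).compMeasurePreservingLp hT hm (by norm_num)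
  have h0 := (h.tendsto 0).edist (tendsto_const_nhds (x := hg.toLp g))
  have e0 : Lp.compMeasurePreserving (T 0) (hm 0) (hg.toLp g) = hg.toLp g := by
    rw [Lp.toLp_compMeasurePreserving]
    congr 1
    ext x
    simp [T]
  rw [e0, edist_self] at h0
  refine h0.congr fun y => ?_
  rw [Lp.toLp_compMeasurePreserving, Lp.edist_toLp_toLp]
  rfl

open ENNReal in
theorem lintegral_mul_shift_average_le {E Y : Type*} [NormedAddCommGroup E] [MeasurableSpace E]
    [BorelSpace E] [SecondCountableTopology E] [MeasurableSpace Y] (μ : Measure E) [SFinite μ]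
    (ν : Measure Y) [SFinite ν]
    {F g : E → ℝ} (hF : Measurable F) (hg : Measurable g) {φ : Y → ℝ} (hφ : Measurable φ)
    {σ : Y → E} (hσ : Measurable σ) (ε : ℝ≥0∞)
    (hε : ∀ y, φ y ≠ 0 → eLpNorm (fun x => g (x - σ y) - g x) 2 μ ≤ ε) :
    ∫⁻ x, ∫⁻ y, ‖F x‖ₑ * (‖φ y‖ₑ * ‖g (x - σ y) - g x‖ₑ) ∂ν ∂μ
      ≤ (∫⁻ y, ‖φ y‖ₑ ∂ν) * (eLpNorm F 2 μ * ε) := by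
  rw [lintegral_lintegral_swap (by fun_prop), ← lintegral_mul_const _ (by fun_prop)]
  refine lintegral_mono fun y => ?_
  by_cases hy : φ y = 0
  · simp [hy]
  calc ∫⁻ x, ‖F x‖ₑ * (‖φ y‖ₑ * ‖g (x - σ y) - g x‖ₑ) ∂μ
      = ‖φ y‖ₑ * ∫⁻ x, ‖F x‖ₑ * ‖g (x - σ y) - g x‖ₑ ∂μ := by
        rw [← lintegral_const_mul _ (by fun_prop)]
        congr 1; ext x; ring
    _ ≤ ‖φ y‖ₑ * (eLpNorm F 2 μ * ε) := by
        gcongr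
        refine le_trans ?_ (mul_le_mul_right (hε y hy) _)
        have := ENNReal.lintegral_mul_le_Lp_mul_Lq μ (p := 2) (q := 2)
          (by constructor <;> norm_num) (f := fun x => ‖F x‖ₑ)
          (g := fun x => ‖g (x - σ y) - g x‖ₑ) (by fun_prop) (by fun_prop)
        rw [eLpNorm_eq_lintegral_rpow_enorm_toReal (by norm_num) (by norm_num),
          eLpNorm_eq_lintegral_rpow_enorm_toReal (by norm_num) (by norm_num)]
        simpa using this

open ENNReal in
theorem enorm_integral_mul_shift_average_sub_le {E Y : Type*} [NormedAddCommGroup E]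
    [MeasurableSpace E] [BorelSpace E] [SecondCountableTopology E] [MeasurableSpace Y]
    (μ : Measure E) [SFinite μ] (ν : Measure Y) [SFinite ν]
    {F g A : E → ℝ} (hF : Measurable F) (hg : Measurable g) {φ : Y → ℝ} (hφ : Measurable φ)
    {σ : Y → E} (hσ : Measurable σ) (ε : ℝ≥0∞)
    (hε : ∀ y, φ y ≠ 0 → eLpNorm (fun x => g (x - σ y) - g x) 2 μ ≤ ε)
    (hφ0 : ∀ y, 0 ≤ φ y) (hφ1 : ∫ y, φ y ∂ν = 1)
    (hA : ∀ᵐ x ∂μ, Integrable (fun y => φ y * g (x - σ y)) ν ∧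
      A x = ∫ y, φ y * g (x - σ y) ∂ν)
    (hFA : Integrable (fun x => F x * A x) μ) (hFg : Integrable (fun x => F x * g x) μ) :
    ‖∫ x, F x * A x ∂μ - ∫ x, F x * g x ∂μ‖ₑ ≤ eLpNorm F 2 μ * ε := by
  have hφi : Integrable φ ν := by
    by_contra h
    rw [integral_undef h] at hφ1
    norm_num at hφ1
  have h1 : ∫⁻ y, ‖φ y‖ₑ ∂ν = 1 := by
    rw [← ofReal_integral_norm_eq_lintegral_enorm hφi]
    simp [abs_of_nonneg (hφ0 _), hφ1]
  rw [← integral_sub hFA hFg]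
  refine (enorm_integral_le_lintegral_enorm _).trans ?_
  have := lintegral_mul_shift_average_le μ ν hF hg hφ hσ ε hε
  rw [h1, one_mul] at this
  refine le_trans (lintegral_mono_ae ?_) this
  filter_upwards [hA] with x hx
  rw [hx.2, ← mul_sub, enorm_mul, lintegral_const_mul _ (by fun_prop)]
  gcongr
  have e : ∫ y, φ y * g (x - σ y) ∂ν - g x = ∫ y, φ y * (g (x - σ y) - g x) ∂ν := by
    simp_rw [mul_sub]
    rw [integral_sub hx.1 (hφi.mul_const _), integral_mul_const, hφ1, one_mul]
  rw [e]
  refine (enorm_integral_le_lintegral_enorm _).trans (le_of_eq ?_)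
  simp_rw [enorm_mul]

theorem exists_mollifier (H : Type*) [NormedAddCommGroup H] [NormedSpace ℝ H]
    [HasContDiffBump H] [FiniteDimensional ℝ H] [MeasurableSpace H] [BorelSpace H]
    (μ : Measure H) [μ.IsAddHaarMeasure] {b : ℝ} (hb : 0 < b) :
    ∃ ψ : H → ℝ, ContDiff ℝ (⊤ : ℕ∞) ψ ∧ (∀ s, 0 ≤ ψ s) ∧ ∫ s, ψ s ∂μ = 1 ∧
      HasCompactSupport ψ ∧ ∀ s, ψ s ≠ 0 → ‖s‖ < b := by
  let B : ContDiffBump (0 : H) := ⟨b / 2, b, by positivity, by linarith⟩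
  refine ⟨B.normed μ, B.contDiff_normed, B.nonneg_normed, B.integral_normed,
    B.hasCompactSupport_normed, fun s hs => ?_⟩
  have : s ∈ Function.support (B.normed μ) := hs
  rw [B.support_normed_eq] at this
  simpa [B] using this

theorem contDiff_mollification {E : Type*} [NormedAddCommGroup E] [NormedSpace ℝ E]
    [FiniteDimensional ℝ E] [MeasurableSpace E] [BorelSpace E] (μ : Measure E) [μ.IsAddHaarMeasure]
    {Φ f : E → ℝ} (hΦ : ContDiff ℝ (⊤ : ℕ∞) Φ) (hΦc : HasCompactSupport Φ) (hf : Continuous f) :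
    ContDiff ℝ (⊤ : ℕ∞) (fun x => ∫ y, Φ y * f (x - y) ∂μ) ∧
    ∀ x v, fderiv ℝ (fun x => ∫ y, Φ y * f (x - y) ∂μ) x v
      = ∫ y, fderiv ℝ Φ y v * f (x - y) ∂μ := by
  have hfl : LocallyIntegrable f μ := hf.locallyIntegrable
  refine ⟨hΦc.contDiff_convolution_left (ContinuousLinearMap.mul ℝ ℝ) hΦ hfl, fun x v => ?_⟩
  have h1 : ContDiff ℝ 1 Φ := hΦ.of_le (by exact_mod_cast le_top)
  have h := hΦc.hasFDerivAt_convolution_left (ContinuousLinearMap.mul ℝ ℝ) h1 hfl x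
  have h' := h.fderiv
  have e : (fun x => ∫ y, Φ y * f (x - y) ∂μ)
    = convolution Φ f (ContinuousLinearMap.mul ℝ ℝ) μ := rfl
  rw [e, h', convolution, ContinuousLinearMap.integral_apply]
  · rfl
  · exact (hΦc.fderiv ℝ).convolutionExists_left
      (ContinuousLinearMap.precompL E (ContinuousLinearMap.mul ℝ ℝ))
      (h1.continuous_fderiv one_ne_zero) hfl x

theorem integral_fderiv_mul_comp_sub {H : Type*} [NormedAddCommGroup H] [NormedSpace ℝ H]
    [FiniteDimensional ℝ H] [MeasurableSpace H] [BorelSpace H] (μ : Measure H) [μ.IsAddHaarMeasure]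
    {ψ f : H → ℝ} (hψ : ContDiff ℝ (⊤ : ℕ∞) ψ) (hψc : HasCompactSupport ψ)
    (hf : Differentiable ℝ f) (v : H) (hfi : Integrable (fun s => fderiv ℝ f s v) μ) (t : H) :
    Integrable (fun s => ψ s * fderiv ℝ f (t - s) v) μ ∧
    ∫ s, fderiv ℝ ψ s v * f (t - s) ∂μ = ∫ s, ψ s * fderiv ℝ f (t - s) v ∂μ := by
  have h1 : ContDiff ℝ 1 ψ := hψ.of_le (by exact_mod_cast le_top)
  have hd : ∀ s, fderiv ℝ (fun s => f (t - s)) s v = - fderiv ℝ f (t - s) v := by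
    intro s
    have := ((hf (t - s)).hasFDerivAt.comp s ((hasFDerivAt_id s).const_sub t)).fderiv
    have e : (f ∘ fun s => t - s) = fun s => f (t - s) := rfl
    rw [e] at this
    rw [this]
    simp
  have h_int : Integrable (fun s => ψ s * fderiv ℝ f (t - s) v) μ := by
    obtain ⟨C, hC⟩ := hψc.exists_bound_of_continuous hψ.continuous
    exact (hfi.comp_sub_left t).bdd_mul hψ.continuous.aestronglyMeasurable (.of_forall hC)
  refine ⟨h_int, ?_⟩
  have hc : Continuous fun s => f (t - s) := hf.continuous.comp (by fun_prop)
  have key := integral_mul_fderiv_eq_neg_fderiv_mul_of_integrable (μ := μ) (𝕜 := ℝ)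
    (f := fun s => f (t - s)) (g := ψ) (v := v) ?_ ?_ ?_ ?_ ?_
  · simp_rw [hd, neg_mul, integral_neg, neg_neg] at key
    simp_rw [mul_comm (ψ _), ← key, mul_comm]
  · simp_rw [hd, neg_mul]
    refine Integrable.neg ?_
    simpa only [mul_comm] using h_int
  · refine (hc.mul ((h1.continuous_fderiv one_ne_zero).clm_apply continuous_const)
      ).integrable_of_hasCompactSupport ?_
    exact ((hψc.fderiv ℝ).comp_left (g := fun L : H →L[ℝ] ℝ => L v) rfl).mul_left
  · exact (hc.mul hψ.continuous).integrable_of_hasCompactSupport hψc.mul_left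
  · exact fun x _ => (hf (t - x)).comp x (by fun_prop)
  · exact fun x _ => (h1.differentiable one_ne_zero) x

instance isAddHaarMeasure_volume_pt : (volume : Measure (Pt m k)).IsAddHaarMeasure :=
  inferInstanceAs
    ((volume : Measure (EuclideanSpace ℝ (Fin m))).prod
      (volume : Measure (EuclideanSpace ℝ (Fin k)))).IsAddHaarMeasure

/-- the directions of the vector fields generating `B_α` -/
def xdir : Fin m ⊕ Fin k → Pt m k := Sum.elim ez et

/-- the weights of the vector fields generating `B_α` -/
def xwt (α : ℝ) (i : Fin m ⊕ Fin k) (p : Pt m k) : ℝ :=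
  Sum.elim (fun _ => 1) (fun _ => ‖p.1‖ ^ α) i

/-- the components of `Xu` -/
def xderiv (α : ℝ) (u : Pt m k → ℝ) (i : Fin m ⊕ Fin k) (p : Pt m k) : ℝ :=
  xwt α i p * fderiv ℝ u p (xdir i)

theorem continuous_xwt {α : ℝ} (hα : 0 < α) (i : Fin m ⊕ Fin k) :
    Continuous (xwt α i : Pt m k → ℝ) := by
  rcases i with i | j
  · exact continuous_const
  · exact (continuous_fst.norm).rpow_const fun _ => Or.inr hα.le

theorem xwt_nonneg (α : ℝ) (i : Fin m ⊕ Fin k) (p : Pt m k) : 0 ≤ xwt α i p := by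
  rcases i with i | j
  · exact zero_le_one
  · exact Real.rpow_nonneg (norm_nonneg _) _

theorem measurable_xderiv {α : ℝ} (hα : 0 < α) (u : Pt m k → ℝ) (i : Fin m ⊕ Fin k) :
    Measurable (xderiv α u i) :=
  (continuous_xwt hα i).measurable.mul (measurable_fderiv_apply_const ℝ u _)

theorem continuous_xderiv {α : ℝ} (hα : 0 < α) {w : Pt m k → ℝ} (hw : ContDiff ℝ (⊤ : ℕ∞) w)
    (i : Fin m ⊕ Fin k) : Continuous (xderiv α w i) :=
  (continuous_xwt hα i).mul
    ((hw.continuous_fderiv (by simp)).clm_apply continuous_const)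

theorem support_xderiv_subset (α : ℝ) (w : Pt m k → ℝ) (i : Fin m ⊕ Fin k) :
    Function.support (xderiv α w i) ⊆ tsupport w := by
  intro p hp
  by_contra h
  have : fderiv ℝ w p = 0 := by
    by_contra h'
    exact h (support_fderiv_subset ℝ h')
  exact hp (by simp [xderiv, this])

theorem hasCompactSupport_xderiv (α : ℝ) {w : Pt m k → ℝ} (hw : HasCompactSupport w)
    (i : Fin m ⊕ Fin k) : HasCompactSupport (xderiv α w i) :=
  hw.mono' (support_xderiv_subset α w i)

theorem xderiv_inl (α : ℝ) (u : Pt m k → ℝ) (i : Fin m) (p : Pt m k) :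
    xderiv α u (.inl i) p = fderiv ℝ u p (ez i) := one_mul _

theorem xderiv_inr (α : ℝ) (u : Pt m k → ℝ) (j : Fin k) (p : Pt m k) :
    xderiv α u (.inr j) p = ‖p.1‖ ^ α * fderiv ℝ u p (et j) := rfl

theorem sum_xderiv_mul (α : ℝ) (u w : Pt m k → ℝ) (p : Pt m k) :
    ∑ i, xderiv α u i p * xderiv α w i p =
      (∑ i : Fin m, fderiv ℝ u p (ez i) * fderiv ℝ w p (ez i))
        + ‖p.1‖ ^ (2*α) * (∑ j : Fin k, fderiv ℝ u p (et j) * fderiv ℝ w p (et j)) := by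
  rw [Fintype.sum_sum_type, Finset.mul_sum]
  have e : ‖p.1‖ ^ (2 * α) = ‖p.1‖ ^ α * ‖p.1‖ ^ α := by
    rw [mul_comm, Real.rpow_mul (norm_nonneg _), Real.rpow_two, sq]
  congr 1
  · exact Finset.sum_congr rfl fun i _ => by rw [xderiv_inl, xderiv_inl]
  · exact Finset.sum_congr rfl fun j _ => by rw [xderiv_inr, xderiv_inr, e]; ring

theorem XgradSq_eq_sum (α : ℝ) (u : Pt m k → ℝ) (p : Pt m k) :
    XgradSq α u p = ∑ i, xderiv α u i p ^ 2 := by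
  simp only [XgradSq, gradzSq, gradtSq, sq, sum_xderiv_mul]

theorem memLp_xderiv_of_contDiff {α : ℝ} (hα : 0 < α) {w : Pt m k → ℝ}
    (hw : ContDiff ℝ (⊤ : ℕ∞) w) (hc : HasCompactSupport w) (i : Fin m ⊕ Fin k) :
    MemLp (xderiv α w i) 2 volume :=
  (continuous_xderiv hα hw i).memLp_of_hasCompactSupport (hasCompactSupport_xderiv α hc i)

theorem integrable_xderiv_of_memLp {α : ℝ} {f : Pt m k → ℝ} (hc : HasCompactSupport f)
    {i : Fin m ⊕ Fin k} (hf : MemLp (xderiv α f i) 2 volume) :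
    Integrable (xderiv α f i) volume := by
  rw [← integrableOn_iff_integrable_of_support_subset (support_xderiv_subset α f i)]
  have : IsFiniteMeasure (volume.restrict (tsupport f)) := ⟨by
    rw [Measure.restrict_apply_univ]; exact IsCompact.measure_lt_top hc⟩
  exact (hf.restrict _).integrable (by norm_num)

/-- partial mollification in the `t` variables of the `t`-derivative -/
def tmoll (ψ : EuclideanSpace ℝ (Fin k) → ℝ) (j : Fin k) (f : Pt m k → ℝ) (x : Pt m k) : ℝ :=
  ∫ s, fderiv ℝ ψ s (EuclideanSpace.single j 1) * f (x - (0, s))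

theorem xwt_mul_tmoll_ae {α : ℝ} {f : Pt m k → ℝ} (hf : Differentiable ℝ f) {j : Fin k}
    (hfi : Integrable (xderiv α f (.inr j)) volume) {ψ : EuclideanSpace ℝ (Fin k) → ℝ}
    (hψ : ContDiff ℝ (⊤ : ℕ∞) ψ) (hψc : HasCompactSupport ψ) :
    ∀ᵐ x : Pt m k, Integrable (fun s => ψ s * xderiv α f (.inr j) (x - (0, s))) volume ∧
      xwt α (.inr j) x * tmoll ψ j f x = ∫ s, ψ s * xderiv α f (.inr j) (x - (0, s)) := by
  have h1 : ∀ᵐ z : EuclideanSpace ℝ (Fin m),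
      Integrable (fun t => xderiv α f (.inr j) (z, t)) volume :=
    Integrable.prod_right_ae hfi
  have h2 : ∀ᵐ x : Pt m k, Integrable (fun t => xderiv α f (.inr j) (x.1, t)) volume :=
    Measure.quasiMeasurePreserving_fst.ae h1
  filter_upwards [h2] with x hx
  let g : EuclideanSpace ℝ (Fin k) → ℝ := fun t => xwt α (.inr j) x * f (x.1, t)
  have hg : ∀ t, HasFDerivAt g (xwt α (.inr j) x •
      (fderiv ℝ f (x.1, t)).comp (ContinuousLinearMap.inr ℝ _ _)) t := fun t =>
    (((hf (x.1, t)).hasFDerivAt.comp t (hasFDerivAt_prodMk_right x.1 t)).const_mul _)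
  have hgd : ∀ t, fderiv ℝ g t (EuclideanSpace.single j 1) = xderiv α f (.inr j) (x.1, t) := by
    intro t
    rw [(hg t).fderiv]
    simp [xderiv, xwt, xdir, et]
  have key := integral_fderiv_mul_comp_sub volume hψ hψc
    (fun t => (hg t).differentiableAt) (EuclideanSpace.single j 1)
    (by simpa only [hgd] using hx) x.2
  simp only [hgd] at key
  have e : ∀ s, x - (0, s) = (x.1, x.2 - s) := fun s => by ext1 <;> simp
  simp only [e, tmoll]
  refine ⟨key.1, ?_⟩
  rw [← key.2, ← integral_const_mul]
  congr 1; ext s; simp only [g]; ring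

theorem mem_cthickening_tsupport {E : Type*} [NormedAddCommGroup E] {f : E → ℝ} {r : ℝ} {x y : E}
    (hy : ‖y‖ ≤ r) (h : f (x - y) ≠ 0) : x ∈ Metric.cthickening r (tsupport f) :=
  Metric.mem_cthickening_of_dist_le x (x - y) r _ (subset_tsupport f h) (by simpa using hy)

theorem abs_fderiv_sub_tmoll_le {f : Pt m k → ℝ} (hf : Continuous f)
    {φ : EuclideanSpace ℝ (Fin m) → ℝ} {ψ : EuclideanSpace ℝ (Fin k) → ℝ}
    (hφ : ContDiff ℝ (⊤ : ℕ∞) φ) (hφc : HasCompactSupport φ) (hφ0 : ∀ z, 0 ≤ φ z)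
    (hφ1 : ∫ z, φ z = 1) (hψ : ContDiff ℝ (⊤ : ℕ∞) ψ) (hψc : HasCompactSupport ψ) {η : ℝ}
    (hη : ∀ (x : Pt m k) z s, φ z ≠ 0 → |f (x - (z, s)) - f (x - (0, s))| ≤ η)
    (j : Fin k) (x : Pt m k) :
    |(∫ y : Pt m k, φ y.1 * fderiv ℝ ψ y.2 (EuclideanSpace.single j 1) * f (x - y))
      - tmoll ψ j f x| ≤ η * ∫ s, |fderiv ℝ ψ s (EuclideanSpace.single j 1)| := by
  set d : EuclideanSpace ℝ (Fin k) → ℝ := fun s => fderiv ℝ ψ s (EuclideanSpace.single j 1)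
  have hdcont : Continuous d := (hψ.continuous_fderiv (by simp)).clm_apply continuous_const
  have hdc : HasCompactSupport d :=
    (hψc.fderiv ℝ).comp_left (g := fun L : _ →L[ℝ] ℝ => L (EuclideanSpace.single j 1)) rfl
  have hP : HasCompactSupport fun y : Pt m k => φ y.1 * d y.2 := by
    refine HasCompactSupport.intro (IsCompact.prod hφc hdc) fun y hy => ?_
    by_contra h
    exact hy ⟨subset_tsupport _ (left_ne_zero_of_mul h), subset_tsupport _ (right_ne_zero_of_mul h)⟩
  have hPcont : Continuous fun y : Pt m k => φ y.1 * d y.2 :=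
    (hφ.continuous.comp continuous_fst).mul (hdcont.comp continuous_snd)
  have e : tmoll ψ j f x = ∫ y : Pt m k, φ y.1 * d y.2 * f (x - (0, y.2)) := by
    have := integral_prod_mul (μ := (volume : Measure (EuclideanSpace ℝ (Fin m))))
      (ν := (volume : Measure (EuclideanSpace ℝ (Fin k)))) φ (fun s => d s * f (x - (0, s)))
    rw [hφ1, one_mul] at this
    rw [tmoll, ← this]
    simp only [mul_assoc]
    rfl
  have i1 : Integrable (fun y : Pt m k => φ y.1 * d y.2 * f (x - y)) :=
    (hPcont.mul (by fun_prop)).integrable_of_hasCompactSupport hP.mul_right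
  have i2 : Integrable (fun y : Pt m k => φ y.1 * d y.2 * f (x - (0, y.2))) :=
    (hPcont.mul (by fun_prop)).integrable_of_hasCompactSupport hP.mul_right
  have e2 : η * ∫ s, |d s| = ∫ y : Pt m k, φ y.1 * (η * |d y.2|) := by
    have := integral_prod_mul (μ := (volume : Measure (EuclideanSpace ℝ (Fin m))))
      (ν := (volume : Measure (EuclideanSpace ℝ (Fin k)))) φ (fun s => η * |d s|)
    rw [hφ1, one_mul, integral_const_mul] at this
    rw [← this]
    rfl
  rw [e, ← integral_sub i1 i2, e2, ← Real.norm_eq_abs]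
  refine norm_integral_le_of_norm_le ?_ (.of_forall fun y => ?_)
  · have e : (fun y : Pt m k => φ y.1 * (η * |d y.2|))
        = (fun _ => η) * fun y : Pt m k => ‖φ y.1 * d y.2‖ := by
      funext y
      simp only [norm_mul, Real.norm_eq_abs, Pi.mul_apply, abs_of_nonneg (hφ0 _)]
      ring
    refine Continuous.integrable_of_hasCompactSupport
      ((hφ.continuous.comp continuous_fst).mul
        (continuous_const.mul (hdcont.comp continuous_snd).abs)) ?_
    exact (congrArg HasCompactSupport e).mpr hP.norm.mul_left
  · rw [← mul_sub, norm_mul, norm_mul, Real.norm_eq_abs, Real.norm_eq_abs, Real.norm_eq_abs,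
      abs_of_nonneg (hφ0 _)]
    by_cases h : φ y.1 = 0
    · simp [h]
    · have := hη x y.1 y.2 h
      calc φ y.1 * |d y.2| * |f (x - y) - f (x - (0, y.2))| ≤ φ y.1 * |d y.2| * η := by
            gcongr
            exact mul_nonneg (hφ0 _) (abs_nonneg _)
        _ = _ := by ring

theorem memLp_xwt_mul_tmoll {α : ℝ} (hα : 0 < α) {f : Pt m k → ℝ} (hf : Continuous f)
    (hc : HasCompactSupport f) {ψ : EuclideanSpace ℝ (Fin k) → ℝ}
    (hψ : ContDiff ℝ (⊤ : ℕ∞) ψ) (hψc : HasCompactSupport ψ) {b : ℝ}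
    (hb : ∀ s, ψ s ≠ 0 → ‖s‖ < b) (j : Fin k) :
    MemLp (fun x => xwt α (.inr j) x * tmoll ψ j f x) 2 volume := by
  set d : EuclideanSpace ℝ (Fin k) → ℝ := fun s => fderiv ℝ ψ s (EuclideanSpace.single j 1)
  have hdcont : Continuous d := (hψ.continuous_fderiv (by simp)).clm_apply continuous_const
  have hdc : HasCompactSupport d :=
    (hψc.fderiv ℝ).comp_left (g := fun L : _ →L[ℝ] ℝ => L (EuclideanSpace.single j 1)) rfl
  have hcont : Continuous (tmoll ψ j f) := by
    have := continuous_parametric_integral_of_continuous (μ := volume) (s := tsupport d)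
      (f := fun (x : Pt m k) (s : EuclideanSpace ℝ (Fin k)) => d s * f (x - (0, s)))
      (by
        change Continuous fun q : Pt m k × EuclideanSpace ℝ (Fin k) => d q.2 * f (q.1 - (0, q.2))
        fun_prop) hdc
    refine this.congr fun x => ?_
    rw [tmoll, setIntegral_eq_integral_of_forall_compl_eq_zero]
    intro s hs
    simp [image_eq_zero_of_notMem_tsupport hs]
  refine ((continuous_xwt hα _).mul hcont).memLp_of_hasCompactSupport (HasCompactSupport.mul_left ?_)
  have hK : IsCompact (Metric.cthickening b (tsupport f)) := IsCompact.cthickening hc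
  refine HasCompactSupport.intro hK fun x hx => ?_
  rw [tmoll]
  refine integral_eq_zero_of_ae (.of_forall fun s => ?_)
  by_contra h
  have hs : d s ≠ 0 := left_ne_zero_of_mul h
  have hs' : s ∈ tsupport ψ := by
    by_contra h'
    refine hs ?_
    have : fderiv ℝ ψ s = 0 := by
      by_contra h''
      exact h' (support_fderiv_subset ℝ h'')
    simp [d, this]
  have hsb : ‖s‖ ≤ b := by
    have : tsupport ψ ⊆ Metric.closedBall 0 b :=
      closure_minimal (fun s hs => by simpa using (hb s hs).le) Metric.isClosed_closedBall
    simpa using this hs'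
  exact hx (mem_cthickening_tsupport (y := ((0 : EuclideanSpace ℝ (Fin m)), s))
    (by simpa [Prod.norm_mk] using hsb) (right_ne_zero_of_mul h))

open Filter Topology ENNReal in
theorem exists_contDiff_approx {α : ℝ} (hα : 0 < α) {f : Pt m k → ℝ} (hf : Differentiable ℝ f)
    (hc : HasCompactSupport f) (hXf : ∀ i, MemLp (xderiv α f i) 2 volume)
    {F : Fin m ⊕ Fin k → Pt m k → ℝ} (hFm : ∀ i, Measurable (F i))
    (hF : ∀ i, MemLp (F i) 2 volume) {r ε : ℝ} (hr : 0 < r) (hε : 0 < ε) :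
    ∃ w : Pt m k → ℝ, ContDiff ℝ (⊤ : ℕ∞) w ∧ HasCompactSupport w ∧
      tsupport w ⊆ Metric.cthickening r (tsupport f) ∧ (∀ p, |w p - f p| ≤ ε) ∧
      ∀ i, |(∫ p, F i p * xderiv α w i p) - ∫ p, F i p * xderiv α f i p| ≤ ε := by
  have hK : IsCompact (Metric.cthickening r (tsupport f)) := IsCompact.cthickening hc
  set K := Metric.cthickening r (tsupport f)
  have huc : UniformContinuous f := hc.uniformContinuous_of_continuous hf.continuous
  -- error budget for the translations
  set N : ℝ := ∑ i, (eLpNorm (F i) 2 volume).toReal with hN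
  have hN0 : 0 ≤ N := Finset.sum_nonneg fun _ _ => ENNReal.toReal_nonneg
  have hNi : ∀ i, (eLpNorm (F i) 2 volume).toReal ≤ N := fun i =>
    Finset.single_le_sum (f := fun i => (eLpNorm (F i) 2 volume).toReal)
      (fun _ _ => ENNReal.toReal_nonneg) (Finset.mem_univ i)
  set e₁ : ℝ := ε / 2 / (N + 1)
  have he₁ : 0 < e₁ := by positivity
  have hbudget : ∀ i, eLpNorm (F i) 2 volume * ENNReal.ofReal e₁ ≤ ENNReal.ofReal (ε / 2) := by
    intro i
    rw [← ENNReal.ofReal_toReal (hF i).2.ne, ← ENNReal.ofReal_mul ENNReal.toReal_nonneg]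
    refine ENNReal.ofReal_le_ofReal ?_
    calc (eLpNorm (F i) 2 volume).toReal * e₁ ≤ (N + 1) * e₁ := by
          gcongr; linarith [hNi i]
      _ = ε / 2 := by simp only [e₁]; field_simp
  have htr : ∀ᶠ y in 𝓝 (0 : Pt m k), ∀ i,
      eLpNorm (fun x => xderiv α f i (x - y) - xderiv α f i x) 2 volume ≤ ENNReal.ofReal e₁ :=
    eventually_all.2 fun i => ENNReal.tendsto_nhds_zero.1
      (tendsto_eLpNorm_sub_translate volume (hXf i)) _ (ENNReal.ofReal_pos.2 he₁)
  obtain ⟨b₀, hb₀, htr⟩ := Metric.eventually_nhds_iff.1 htr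
  obtain ⟨b₁, hb₁, hu₁⟩ := Metric.uniformContinuous_iff.1 huc ε hε
  obtain ⟨b, hb, hbb₀, hbb₁, hbr⟩ : ∃ b, 0 < b ∧ b ≤ b₀ ∧ b ≤ b₁ ∧ b ≤ r :=
    ⟨min b₀ (min b₁ r), by positivity, min_le_left _ _,
      (min_le_right _ _).trans (min_le_left _ _), (min_le_right _ _).trans (min_le_right _ _)⟩
  obtain ⟨ψ, hψ, hψ0, hψ1, hψc, hψb⟩ := exists_mollifier (EuclideanSpace ℝ (Fin k)) volume hb
  -- error budget for the mollification in `z`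
  set L : Fin k → ℝ := fun j => ∫ s, |fderiv ℝ ψ s (EuclideanSpace.single j 1)|
  set M : Fin k → ℝ := fun j => ∫ x in K, |F (.inr j) x| * xwt α (.inr j) x
  have hL0 : ∀ j, 0 ≤ L j := fun j => integral_nonneg fun _ => abs_nonneg _
  have hM0 : ∀ j, 0 ≤ M j := fun j =>
    integral_nonneg fun x => mul_nonneg (abs_nonneg _) (xwt_nonneg _ _ _)
  set Q : ℝ := ∑ j, L j * M j
  have hQ0 : 0 ≤ Q := Finset.sum_nonneg fun j _ => mul_nonneg (hL0 j) (hM0 j)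
  have hQj : ∀ j, L j * M j ≤ Q := fun j =>
    Finset.single_le_sum (f := fun j => L j * M j)
      (fun j _ => mul_nonneg (hL0 j) (hM0 j)) (Finset.mem_univ j)
  set η : ℝ := ε / 2 / (Q + 1)
  have hη : 0 < η := by positivity
  obtain ⟨a₁, ha₁, hu₂⟩ := Metric.uniformContinuous_iff.1 huc η hη
  obtain ⟨a, ha, haa₁, hab⟩ : ∃ a, 0 < a ∧ a ≤ a₁ ∧ a ≤ b :=
    ⟨min a₁ b, by positivity, min_le_left _ _, min_le_right _ _⟩
  obtain ⟨φ, hφ, hφ0, hφ1, hφc, hφa⟩ := exists_mollifier (EuclideanSpace ℝ (Fin m)) volume ha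
  set Φ : Pt m k → ℝ := fun y => φ y.1 * ψ y.2 with hΦdef
  have hΦ : ContDiff ℝ (⊤ : ℕ∞) Φ := (hφ.comp contDiff_fst).mul (hψ.comp contDiff_snd)
  have hΦc : HasCompactSupport Φ := by
    refine HasCompactSupport.intro (IsCompact.prod hφc hψc) fun y hy => ?_
    by_contra h
    exact hy ⟨subset_tsupport _ (left_ne_zero_of_mul h), subset_tsupport _ (right_ne_zero_of_mul h)⟩
  have hΦ0 : ∀ y, 0 ≤ Φ y := fun y => mul_nonneg (hφ0 _) (hψ0 _)
  have hΦ1 : ∫ y, Φ y = 1 := by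
    have := integral_prod_mul (μ := (volume : Measure (EuclideanSpace ℝ (Fin m))))
      (ν := (volume : Measure (EuclideanSpace ℝ (Fin k)))) φ ψ
    rw [hφ1, hψ1, one_mul] at this
    exact this
  have hΦb : ∀ y, Φ y ≠ 0 → ‖y‖ < b := fun y hy => max_lt
    ((hφa _ (left_ne_zero_of_mul hy)).trans_le hab) (hψb _ (right_ne_zero_of_mul hy))
  have hΦi : Integrable Φ := hΦ.continuous.integrable_of_hasCompactSupport hΦc
  obtain ⟨hw, hwd⟩ := contDiff_mollification volume hΦ hΦc hf.continuous
  set w : Pt m k → ℝ := fun x => ∫ y, Φ y * f (x - y)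
  have hws : Function.support w ⊆ K := by
    intro x hx
    by_contra h
    refine hx (integral_eq_zero_of_ae (.of_forall fun y => ?_))
    by_contra h'
    exact h (mem_cthickening_tsupport ((hΦb y (left_ne_zero_of_mul h')).le.trans hbr)
      (right_ne_zero_of_mul h'))
  have hwK : tsupport w ⊆ K := closure_minimal hws Metric.isClosed_cthickening
  have hwc : HasCompactSupport w := hK.of_isClosed_subset (isClosed_tsupport _) hwK
  have hfK : tsupport f ⊆ K := Metric.self_subset_cthickening _
  have hFX : ∀ i, Integrable (fun p => F i p * xderiv α w i p) := fun i =>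
    (hF i).integrable_mul (memLp_xderiv_of_contDiff hα hw hwc i)
  have hFf : ∀ i, Integrable (fun p => F i p * xderiv α f i p) := fun i =>
    (hF i).integrable_mul (hXf i)
  refine ⟨w, hw, hwc, hwK, fun p => ?_, fun i => ?_⟩
  · have i1 : Integrable (fun y => Φ y * f (p - y)) :=
      (hΦ.continuous.mul (hf.continuous.comp (by fun_prop))).integrable_of_hasCompactSupport
        hΦc.mul_right
    have e : w p - f p = ∫ y, Φ y * (f (p - y) - f p) := by
      simp_rw [mul_sub]
      rw [integral_sub i1 (hΦi.mul_const _), integral_mul_const, hΦ1, one_mul]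
    rw [e, ← Real.norm_eq_abs]
    have : ε = ∫ y, Φ y * ε := by rw [integral_mul_const, hΦ1, one_mul]
    rw [this]
    refine norm_integral_le_of_norm_le (hΦi.mul_const _) (.of_forall fun y => ?_)
    rw [norm_mul, Real.norm_eq_abs, abs_of_nonneg (hΦ0 y)]
    by_cases hy : Φ y = 0
    · simp [hy]
    · refine mul_le_mul_of_nonneg_left ?_ (hΦ0 y)
      have := hu₁ (a := p - y) (b := p) (by simpa [dist_eq_norm] using (hΦb y hy).trans_le hbb₁)
      exact (Real.dist_eq _ _ ▸ this).le
  have habs : ∀ {x : ℝ}, ‖x‖ₑ ≤ ENNReal.ofReal (ε / 2) → |x| ≤ ε / 2 := fun {x} h => by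
    rw [← Real.norm_eq_abs]
    rw [← ofReal_norm] at h
    exact (ENNReal.ofReal_le_ofReal_iff (by positivity)).1 h
  rcases i with i | j
  · refine (habs (le_trans ?_ (hbudget (.inl i)))).trans (by linarith)
    refine enorm_integral_mul_shift_average_sub_le volume volume (hFm _) (measurable_xderiv hα f _)
      hΦ.continuous.measurable (σ := id) measurable_id _ (fun y hy => htr ?_ _) hΦ0 hΦ1
      (.of_forall fun x => ?_) (hFX _) (hFf _)
    · simpa using (hΦb y hy).trans_le hbb₀
    · have := integral_fderiv_mul_comp_sub volume hΦ hΦc hf (ez i)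
        ((integrable_xderiv_of_memLp hc (hXf (.inl i))).congr
          (.of_forall fun p => xderiv_inl α f i p)) x
      simp only [xderiv_inl, id]
      exact ⟨this.1, (hwd x _).trans this.2⟩
  · have h1 : |(∫ p, F (.inr j) p * (xwt α (.inr j) p * tmoll ψ j f p))
        - ∫ p, F (.inr j) p * xderiv α f (.inr j) p| ≤ ε / 2 := by
      refine habs (le_trans ?_ (hbudget (.inr j)))
      refine enorm_integral_mul_shift_average_sub_le volume volume (hFm _)
        (measurable_xderiv hα f _) hψ.continuous.measurable
        (σ := fun s => ((0 : EuclideanSpace ℝ (Fin m)), s)) (by fun_prop) _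
        (fun s hs => htr ?_ _) hψ0 hψ1
        (xwt_mul_tmoll_ae hf (integrable_xderiv_of_memLp hc (hXf (.inr j))) hψ hψc) ?_ (hFf _)
      · simpa [Prod.norm_mk] using (hψb s hs).trans_le hbb₀
      · exact (hF _).integrable_mul (memLp_xwt_mul_tmoll hα hf.continuous hc hψ hψc hψb j)
    have hft : Integrable fun p => F (.inr j) p * (xwt α (.inr j) p * tmoll ψ j f p) :=
      (hF _).integrable_mul (memLp_xwt_mul_tmoll hα hf.continuous hc hψ hψc hψb j)
    have hdiff : ∀ x, |fderiv ℝ w x (et j) - tmoll ψ j f x| ≤ η * L j := by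
      intro x
      have := abs_fderiv_sub_tmoll_le hf.continuous hφ hφc hφ0 hφ1 hψ hψc (η := η)
        (fun x z s hz => ?_) j x
      · rw [hwd]
        convert this using 5 with y
        congr 1
        have h1 := (hφ.differentiable (by simp) y.1).hasFDerivAt.comp y
          (hasFDerivAt_fst (𝕜 := ℝ) (p := y))
        have h2 := (hψ.differentiable (by simp) y.2).hasFDerivAt.comp y
          (hasFDerivAt_snd (𝕜 := ℝ) (p := y))
        have h3 : HasFDerivAt Φ _ y := h1.mul h2
        rw [h3.fderiv]
        simp [et]
      · have := hu₂ (a := x - (z, s)) (b := x - (0, s)) (by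
          simpa [dist_eq_norm, Prod.norm_mk] using (hφa z hz).trans_le haa₁)
        exact (Real.dist_eq _ _ ▸ this).le
    have h2 : |(∫ p, F (.inr j) p * xderiv α w (.inr j) p)
        - ∫ p, F (.inr j) p * (xwt α (.inr j) p * tmoll ψ j f p)| ≤ ε / 2 := by
      rw [← integral_sub (hFX _) hft]
      have hz : ∀ x, x ∉ K → F (.inr j) x * xderiv α w (.inr j) x
          - F (.inr j) x * (xwt α (.inr j) x * tmoll ψ j f x) = 0 := by
        intro x hx
        have e1 : xderiv α w (.inr j) x = 0 := by
          by_contra h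
          exact hx (hwK (support_xderiv_subset α w _ h))
        have e2 : tmoll ψ j f x = 0 := by
          rw [tmoll]
          refine integral_eq_zero_of_ae (.of_forall fun s => ?_)
          by_contra h
          have hs : s ∈ tsupport ψ := by
            by_contra h'
            refine left_ne_zero_of_mul h ?_
            have : fderiv ℝ ψ s = 0 := by
              by_contra h''
              exact h' (support_fderiv_subset ℝ h'')
            simp [this]
          have : tsupport ψ ⊆ Metric.closedBall 0 b :=
            closure_minimal (fun s hs => by simpa using (hψb s hs).le) Metric.isClosed_closedBall
          have hsb : ‖s‖ ≤ b := by simpa using this hs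
          exact hx (mem_cthickening_tsupport (y := ((0 : EuclideanSpace ℝ (Fin m)), s))
            (by simpa [Prod.norm_mk] using hsb.trans hbr) (right_ne_zero_of_mul h))
        rw [e1, e2]; ring
      rw [← setIntegral_eq_integral_of_forall_compl_eq_zero hz, ← Real.norm_eq_abs]
      have hfin : IsFiniteMeasure (volume.restrict K) :=
        ⟨by rw [Measure.restrict_apply_univ]; exact hK.measure_lt_top⟩
      have hMi : Integrable (fun x => |F (.inr j) x| * xwt α (.inr j) x) (volume.restrict K) := by
        obtain ⟨C, hC⟩ := hK.exists_bound_of_continuousOn (continuous_xwt hα (.inr j)).continuousOn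
        refine (((hF (.inr j)).restrict K).integrable (by norm_num)).norm.mul_bdd
          (continuous_xwt hα (.inr j)).aestronglyMeasurable (c := C) ?_
        exact ae_restrict_of_forall_mem hK.measurableSet hC
      calc _ ≤ ∫ x in K, |F (.inr j) x| * xwt α (.inr j) x * (η * L j) := by
            refine norm_integral_le_of_norm_le (hMi.mul_const _) (.of_forall fun x => ?_)
            rw [← mul_sub, xderiv, ← mul_sub, norm_mul, norm_mul, Real.norm_eq_abs,
              Real.norm_eq_abs, Real.norm_eq_abs, abs_of_nonneg (xwt_nonneg α _ x), ← mul_assoc]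
            exact mul_le_mul_of_nonneg_left (hdiff x)
              (mul_nonneg (abs_nonneg _) (xwt_nonneg _ _ _))
        _ = η * (L j * M j) := by rw [integral_mul_const]; simp only [M]; ring
        _ ≤ η * (Q + 1) := by gcongr; linarith [hQj j]
        _ = ε / 2 := by simp only [η]; field_simp
    calc _ ≤ _ := abs_sub_le _ _ _
      _ ≤ ε / 2 + ε / 2 := add_le_add h2 h1
      _ = ε := by ring

theorem memLp_indicator_xderiv {α : ℝ} (hα : 0 < α) {u : Pt m k → ℝ} {K : Set (Pt m k)}
    (hK : MeasurableSet K) (hu : IntegrableOn (XgradSq α u) K) (i : Fin m ⊕ Fin k) :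
    MemLp (K.indicator (xderiv α u i)) 2 volume := by
  rw [memLp_indicator_iff_restrict hK,
    memLp_two_iff_integrable_sq (measurable_xderiv hα u i).aestronglyMeasurable]
  refine Integrable.mono' hu ((measurable_xderiv hα u i).pow_const 2).aestronglyMeasurable
    (.of_forall fun p => ?_)
  rw [XgradSq_eq_sum, Real.norm_eq_abs, abs_of_nonneg (sq_nonneg _)]
  exact Finset.single_le_sum (f := fun i => xderiv α u i p ^ 2) (fun _ _ => sq_nonneg _)
    (Finset.mem_univ i)

theorem xderiv_sq_mul_sub {α : ℝ} {u η : Pt m k → ℝ} (hu : Differentiable ℝ u)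
    (hη : ContDiff ℝ (⊤ : ℕ∞) η) (c : ℝ) (i : Fin m ⊕ Fin k) (p : Pt m k) :
    xderiv α (fun p => η p ^ 2 * (u p - c)) i p
      = η p ^ 2 * xderiv α u i p + 2 * η p * (u p - c) * xderiv α η i p := by
  have h1 := (hη.differentiable (by simp) p).hasFDerivAt
  have h2 := (h1.pow 2).mul ((hu p).hasFDerivAt.sub_const c)
  have h3 : HasFDerivAt (fun p => η p ^ 2 * (u p - c)) _ p := h2
  rw [xderiv, h3.fderiv]
  simp [xderiv]
  ring

/-- The weak inequality, tested against the non-smooth function `f`. -/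
theorem sum_integral_xderiv_mul_le {α : ℝ} (hα : 0 < α) {u κ : Pt m k → ℝ} {Ω : Set (Pt m k)}
    (hu : Differentiable ℝ u) (hκ : ContinuousOn κ Ω) (hκ0 : ∀ p ∈ Ω, 0 ≤ κ p)
    (hT : ∀ w : Pt m k → ℝ, ContDiff ℝ (⊤ : ℕ∞) w → HasCompactSupport w → tsupport w ⊆ Ω →
      |∫ p, ∑ i, xderiv α u i p * xderiv α w i p| ≤ ∫ p, κ p * |u p| * |w p|)
    {f : Pt m k → ℝ} (hf : Differentiable ℝ f) (hc : HasCompactSupport f)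
    (hXf : ∀ i, MemLp (xderiv α f i) 2 volume) {r : ℝ} (hr : 0 < r)
    (hrΩ : Metric.cthickening r (tsupport f) ⊆ Ω)
    (hX : IntegrableOn (XgradSq α u) (Metric.cthickening r (tsupport f))) :
    ∑ i, ∫ p, (Metric.cthickening r (tsupport f)).indicator (xderiv α u i) p * xderiv α f i p
      ≤ ∫ p, κ p * |u p| * |f p| := by
  have hK : IsCompact (Metric.cthickening r (tsupport f)) := IsCompact.cthickening hc
  have hfK : tsupport f ⊆ Metric.cthickening r (tsupport f) := Metric.self_subset_cthickening _
  set K := Metric.cthickening r (tsupport f)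
  set F : Fin m ⊕ Fin k → Pt m k → ℝ := fun i => K.indicator (xderiv α u i)
  have hFm : ∀ i, Measurable (F i) := fun i =>
    (measurable_xderiv hα u i).indicator hK.measurableSet
  have hF : ∀ i, MemLp (F i) 2 volume := memLp_indicator_xderiv hα hK.measurableSet hX
  have hκu : IntegrableOn (fun p => κ p * |u p|) K :=
    ((hκ.mono hrΩ).mul hu.continuous.abs.continuousOn).integrableOn_compact hK
  have h_int : ∀ g : Pt m k → ℝ, Continuous g → (∀ p ∉ K, g p = 0) →
      Integrable (fun p => κ p * |u p| * |g p|) := by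
    intro g hg hgK
    rw [← integrableOn_iff_integrable_of_support_subset (s := K)]
    · exact (((hκ.mono hrΩ).mul hu.continuous.abs.continuousOn).mul
        hg.abs.continuousOn).integrableOn_compact hK
    · intro p hp
      by_contra h
      exact hp (by simp [hgK p h])
  set B : ℝ := ∫ p in K, κ p * |u p|
  have hB : 0 ≤ B := setIntegral_nonneg hK.measurableSet fun p hp =>
    mul_nonneg (hκ0 p (hrΩ hp)) (abs_nonneg _)
  have step : ∀ ε > 0, ∑ i, ∫ p, F i p * xderiv α f i p
      ≤ (∫ p, κ p * |u p| * |f p|) + ε * (B + (m + k)) := by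
    intro ε hε
    obtain ⟨w, hw, hwc, hwK, hwf, hwX⟩ := exists_contDiff_approx hα hf hc hXf hFm hF hr hε
    have hw0 : ∀ p ∉ K, w p = 0 := fun p hp =>
      image_eq_zero_of_notMem_tsupport fun h => hp (hwK h)
    have hf0 : ∀ p ∉ K, f p = 0 := fun p hp =>
      image_eq_zero_of_notMem_tsupport fun h => hp (hfK h)
    have e1 : ∫ p, ∑ i, xderiv α u i p * xderiv α w i p = ∑ i, ∫ p, F i p * xderiv α w i p := by
      rw [← integral_finsetSum]
      · congr 1; ext p
        refine Finset.sum_congr rfl fun i _ => ?_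
        by_cases hp : p ∈ K
        · simp [F, hp]
        · have : xderiv α w i p = 0 := by
            by_contra h
            exact hp (hwK (support_xderiv_subset α w _ h))
          simp [this]
      · exact fun i _ => (hF i).integrable_mul (memLp_xderiv_of_contDiff hα hw hwc i)
    have h1 := (le_abs_self _).trans (hT w hw hwc (hwK.trans hrΩ))
    rw [e1] at h1
    have h2 : ∑ i, ∫ p, F i p * xderiv α f i p
        ≤ ∑ i, ((∫ p, F i p * xderiv α w i p) + ε) :=
      Finset.sum_le_sum fun i _ => by linarith [(abs_le.1 (hwX i)).1]
    have h3 : ∑ i : Fin m ⊕ Fin k, ((∫ p, F i p * xderiv α w i p) + ε)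
        = (∑ i, ∫ p, F i p * xderiv α w i p) + ε * (m + k) := by
      rw [Finset.sum_add_distrib]
      simp [mul_comm]
    have h4 : ∫ p, κ p * |u p| * |w p| ≤ (∫ p, κ p * |u p| * |f p|) + ε * B := by
      have i1 := h_int f hf.continuous hf0
      have i2 : Integrable (K.indicator fun p => ε * (κ p * |u p|)) :=
        IntegrableOn.integrable_indicator (hκu.const_mul ε) hK.measurableSet
      have e2 : ε * B = ∫ p, K.indicator (fun p => ε * (κ p * |u p|)) p := by
        rw [integral_indicator hK.measurableSet, integral_const_mul]
      rw [e2, ← integral_add i1 i2]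
      refine integral_mono (h_int w hw.continuous hw0) (i1.add i2) fun p => ?_
      by_cases hp : p ∈ K
      · have h5 : |w p| ≤ |f p| + ε := by
          have := abs_sub_abs_le_abs_sub (w p) (f p)
          linarith [hwf p]
        have h6 : 0 ≤ κ p * |u p| := mul_nonneg (hκ0 p (hrΩ hp)) (abs_nonneg _)
        simp only [Set.indicator_of_mem hp]
        calc _ ≤ κ p * |u p| * (|f p| + ε) := by gcongr
          _ = _ := by ring
      · simp [hw0 p hp, hf0 p hp, hp]
    linarith
  refine le_of_forall_pos_le_add fun ε hε => ?_
  have hpos : 0 < B + (m + k) + 1 := by positivity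
  refine (step (ε / (B + (m + k) + 1)) (by positivity)).trans ?_
  gcongr
  rw [div_mul_eq_mul_div, div_le_iff₀ hpos]
  nlinarith

theorem caccioppoli_cutoff {α : ℝ} (hα : 0 < α) {u κ : Pt m k → ℝ} {Ω U : Set (Pt m k)}
    (hu : Differentiable ℝ u) (hκ : ContinuousOn κ Ω) (hκ0 : ∀ p ∈ Ω, 0 ≤ κ p)
    (hT : ∀ w : Pt m k → ℝ, ContDiff ℝ (⊤ : ℕ∞) w → HasCompactSupport w → tsupport w ⊆ Ω →
      |∫ p, ∑ i, xderiv α u i p * xderiv α w i p| ≤ ∫ p, κ p * |u p| * |w p|)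
    (hU : IsOpen U) (hUΩ : U ⊆ Ω) (hX : LocallyIntegrableOn (XgradSq α u) U)
    {η : Pt m k → ℝ} (hη : ContDiff ℝ (⊤ : ℕ∞) η) (hηc : HasCompactSupport η)
    (hηU : tsupport η ⊆ U) (c : ℝ) :
    Integrable (fun p => η p ^ 2 * XgradSq α u p) ∧
    ∫ p, η p ^ 2 * XgradSq α u p ≤ ∫ p, (2 * (κ p * |u p| * (η p ^ 2 * |u p - c|))
      + 4 * ((u p - c) ^ 2 * XgradSq α η p)) := by
  obtain ⟨r, hr, hrU⟩ := hηc.exists_cthickening_subset_open hU hηU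
  set f : Pt m k → ℝ := fun p => η p ^ 2 * (u p - c) with hfdef
  have hfη : tsupport f ⊆ tsupport η := closure_mono fun p hp h => hp (by simp [f, h])
  have hfc : HasCompactSupport f := hηc.of_isClosed_subset (isClosed_tsupport _) hfη
  have hKU : Metric.cthickening r (tsupport f) ⊆ U :=
    (Metric.cthickening_subset_of_subset r hfη).trans hrU
  have hK' : IsCompact (Metric.cthickening r (tsupport f)) := IsCompact.cthickening hfc
  have hfd : Differentiable ℝ f := ((hη.differentiable (by simp)).pow 2).mul (hu.sub_const c)
  set S := tsupport η with hS
  have hSX : IntegrableOn (XgradSq α u) S := hX.integrableOn_compact_subset hηU hηc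
  have hη0 : ∀ p ∉ S, η p = 0 := fun p hp => image_eq_zero_of_notMem_tsupport hp
  obtain ⟨Cη, hCη⟩ := hηc.exists_bound_of_continuous hη.continuous
  have hXf : ∀ i, MemLp (xderiv α f i) 2 volume := by
    intro i
    have e : xderiv α f i = (fun p => η p ^ 2 * S.indicator (xderiv α u i) p)
        + fun p => 2 * η p * (u p - c) * xderiv α η i p := by
      funext p
      rw [xderiv_sq_mul_sub hu hη, Pi.add_apply]
      by_cases hp : p ∈ S
      · simp [hp]
      · simp [hη0 p hp]
    rw [e]
    refine MemLp.add ?_ ?_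
    · refine ((memLp_indicator_xderiv hα (isClosed_tsupport η).measurableSet hSX i)).of_le_mul
        (c := Cη ^ 2) ?_ (.of_forall fun p => ?_)
      · exact ((hη.continuous.measurable.pow_const 2).mul ((measurable_xderiv hα u i).indicator
          (isClosed_tsupport η).measurableSet)).aestronglyMeasurable
      · rw [norm_mul, norm_pow]
        gcongr
        exact hCη p
    · refine Continuous.memLp_of_hasCompactSupport ?_
        (HasCompactSupport.mul_left (hasCompactSupport_xderiv α hηc i))
      exact ((continuous_const.mul hη.continuous).mul (hu.continuous.sub continuous_const)).mul
        (continuous_xderiv hα hη i)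
  have main := sum_integral_xderiv_mul_le hα hu hκ hκ0 hT hfd hfc hXf hr (hKU.trans hUΩ)
    (hX.integrableOn_compact_subset hKU hK')
  rw [← integral_finsetSum] at main
  swap
  · exact fun i _ => (memLp_indicator_xderiv hα hK'.measurableSet
      (hX.integrableOn_compact_subset hKU hK') i).integrable_mul (hXf i)
  have iL : Integrable (fun p => ∑ i, (Metric.cthickening r (tsupport f)).indicator
      (xderiv α u i) p * xderiv α f i p) :=
    integrable_finsetSum _ fun i _ => (memLp_indicator_xderiv hα hK'.measurableSet
      (hX.integrableOn_compact_subset hKU hK') i).integrable_mul (hXf i)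
  have hgη : Continuous (XgradSq α η) := by
    have : XgradSq α η = fun p => ∑ i, xderiv α η i p ^ 2 := funext (XgradSq_eq_sum α η)
    rw [this]
    exact continuous_finsetSum _ fun i _ => (continuous_xderiv hα hη i).pow 2
  have hgη0 : ∀ p ∉ S, XgradSq α η p = 0 := by
    intro p hp
    rw [XgradSq_eq_sum]
    refine Finset.sum_eq_zero fun i _ => ?_
    have : xderiv α η i p = 0 := by
      by_contra h
      exact hp (support_xderiv_subset α η i h)
    simp [this]
  have iX : Integrable (fun p => η p ^ 2 * XgradSq α u p) := by
    rw [← integrableOn_iff_integrable_of_support_subset (s := S)]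
    · refine hSX.bdd_mul (c := Cη ^ 2) (hη.continuous.pow 2).aestronglyMeasurable
        (.of_forall fun p => ?_)
      rw [norm_pow]
      gcongr
      exact hCη p
    · intro p hp
      by_contra h
      exact hp (by simp [hη0 p h])
  have iκ : Integrable (fun p => κ p * |u p| * (η p ^ 2 * |u p - c|)) := by
    rw [← integrableOn_iff_integrable_of_support_subset (s := S)]
    · refine ContinuousOn.integrableOn_compact hηc ?_
      exact ((hκ.mono (hηU.trans hUΩ)).mul hu.continuous.abs.continuousOn).mul
        ((hη.continuous.pow 2).mul (hu.continuous.sub continuous_const).abs).continuousOn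
    · intro p hp
      by_contra h
      exact hp (by simp [hη0 p h])
  have iη : Integrable (fun p => (u p - c) ^ 2 * XgradSq α η p) := by
    refine Continuous.integrable_of_hasCompactSupport
      (((hu.continuous.sub continuous_const).pow 2).mul hgη) ?_
    exact HasCompactSupport.intro hηc fun p hp => by simp [hgη0 p hp]
  refine ⟨iX, ?_⟩
  have hlow : ∫ p, (1 / 2 * (η p ^ 2 * XgradSq α u p) - 2 * ((u p - c) ^ 2 * XgradSq α η p))
      ≤ ∫ p, κ p * |u p| * |f p| := by
    refine le_trans (integral_mono ((iX.const_mul _).sub (iη.const_mul _)) iL fun p => ?_) main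
    dsimp only
    rw [XgradSq_eq_sum, XgradSq_eq_sum, Finset.mul_sum, Finset.mul_sum, Finset.mul_sum,
      Finset.mul_sum, ← Finset.sum_sub_distrib]
    refine Finset.sum_le_sum fun i _ => ?_
    have e : (Metric.cthickening r (tsupport f)).indicator (xderiv α u i) p * xderiv α f i p
        = xderiv α u i p * xderiv α f i p := by
      by_cases hp : p ∈ Metric.cthickening r (tsupport f)
      · simp [hp]
      · have : xderiv α f i p = 0 := by
          by_contra h
          exact hp (Metric.self_subset_cthickening _ (support_xderiv_subset α f i h))
        simp [this]
    rw [e, xderiv_sq_mul_sub hu hη]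
    nlinarith [sq_nonneg (η p * xderiv α u i p + 2 * (u p - c) * xderiv α η i p)]
  rw [integral_sub (iX.const_mul _) (iη.const_mul _), integral_const_mul, integral_const_mul]
    at hlow
  rw [integral_add (iκ.const_mul _) (iη.const_mul _), integral_const_mul, integral_const_mul]
  have e : ∫ p, κ p * |u p| * |f p| = ∫ p, κ p * |u p| * (η p ^ 2 * |u p - c|) := by
    congr 1; ext p
    simp only [f, abs_mul, abs_of_nonneg (sq_nonneg (η p))]
  linarith

open Set Metric in
theorem measure_le_of_forall_ball {E : Type*} [NormedAddCommGroup E] [NormedSpace ℝ E]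
    [FiniteDimensional ℝ E] [MeasurableSpace E] [BorelSpace E] (μ : Measure E)
    [μ.IsAddHaarMeasure] (ν : Measure E) {S J : Set E} {d : E → ℝ} {R : ℝ} {C : ENNReal}
    (hd0 : ∀ x ∈ S, 0 < d x) (hdR : ∀ x ∈ S, d x ≤ R) (hJ : ∀ x ∈ S, ball x (d x) ⊆ J)
    (hν : ∀ x ∈ S, ν (ball x (d x / 2)) ≤ C * μ (ball x (d x))) :
    ν S ≤ C * (ENNReal.ofReal (12 ^ Module.finrank ℝ E) * μ J) := by
  obtain ⟨T, hTS, hTd, hTc⟩ := Vitali.exists_disjoint_subfamily_covering_enlargement_closedBall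
    S id (fun x => d x / 12) (R / 12) (fun x hx => by linarith [hdR x hx]) 5 (by norm_num)
  have hTcount : T.Countable := by
    refine hTd.countable_of_nonempty_interior fun x hx => ⟨x, ?_⟩
    exact ball_subset_interior_closedBall (mem_ball_self (by have := hd0 x (hTS hx); positivity))
  have hcov : S ⊆ ⋃ x ∈ T, ball x (d x / 2) := by
    intro x hx
    obtain ⟨b, hb, hxb⟩ := hTc x hx
    refine mem_iUnion₂.2 ⟨b, hb, ?_⟩
    have h1 := hxb (mem_closedBall_self (by have := hd0 x hx; positivity))
    have h2 := hd0 b (hTS hb)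
    rw [mem_closedBall] at h1
    rw [mem_ball]
    simp only [id] at h1
    linarith
  have hball : ∀ x ∈ T, μ (ball x (d x))
      ≤ ENNReal.ofReal (12 ^ Module.finrank ℝ E) * μ (closedBall x (d x / 12)) := by
    intro x hx
    have h2 := hd0 x (hTS hx)
    have h3 := Measure.addHaar_ball_mul_of_pos μ x (r := 12) (by norm_num) (d x / 12)
    rw [show 12 * (d x / 12) = d x by ring, ← Measure.addHaar_ball_center μ x] at h3
    rw [h3]
    gcongr
    exact ball_subset_closedBall
  have : Countable T := hTcount.to_subtype
  calc ν S ≤ ν (⋃ x ∈ T, ball x (d x / 2)) := measure_mono hcov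
    _ ≤ ∑' x : T, ν (ball x (d x / 2)) := by
        rw [biUnion_eq_iUnion]; exact measure_iUnion_le _
    _ ≤ ∑' x : T, C * (ENNReal.ofReal (12 ^ Module.finrank ℝ E)
          * μ (closedBall (x : E) (d x / 12))) := by
        refine ENNReal.tsum_le_tsum fun x => ?_
        exact (hν x (hTS x.2)).trans (by gcongr; exact hball x x.2)
    _ = C * (ENNReal.ofReal (12 ^ Module.finrank ℝ E)
          * ∑' x : T, μ (closedBall (x : E) (d x / 12))) := by
        rw [ENNReal.tsum_mul_left, ENNReal.tsum_mul_left]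
    _ = C * (ENNReal.ofReal (12 ^ Module.finrank ℝ E)
          * μ (⋃ x ∈ T, closedBall (x : E) (d x / 12))) := by
        rw [measure_biUnion (f := fun x => closedBall x (d x / 12)) hTcount hTd
          fun x _ => isClosed_closedBall.measurableSet]
    _ ≤ _ := by
        gcongr
        refine iUnion₂_subset fun x hx => ?_
        refine (closedBall_subset_ball ?_).trans (hJ x (hTS hx))
        have := hd0 x (hTS hx); linarith

open Set Metric Filter Topology in
/-- A differentiable function satisfies a uniform Lipschitz bound at the points of some nonempty
relatively open part of any given nonempty locally closed set. -/
theorem exists_ball_lipschitz_at {E : Type*} [NormedAddCommGroup E] [NormedSpace ℝ E]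
    [FiniteDimensional ℝ E] {u : E → ℝ} (hu : Differentiable ℝ u) {F : Set E}
    (hF : IsLocallyClosed F) (hne : F.Nonempty) :
    ∃ y₀ ∈ F, ∃ r > 0, ∃ n : ℕ, ∀ y ∈ F, dist y y₀ < r →
      ∀ v : E, ‖v‖ ≤ 1 / (n + 1 : ℝ) → |u (y + v) - u y| ≤ n * ‖v‖ := by
  have : ProperSpace E := FiniteDimensional.proper ℝ E
  have : LocallyCompactSpace F := hF.locallyCompactSpace
  have : Nonempty F := hne.to_subtype
  let T : ℕ → Set F := fun n =>
    {y | ∀ v : E, ‖v‖ ≤ 1 / (n + 1 : ℝ) → |u (y + v) - u y| ≤ n * ‖v‖}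
  have hTc : ∀ n, IsClosed (T n) := by
    intro n
    simp only [T, ofPred_forall]
    refine isClosed_iInter fun v => isClosed_iInter fun _ => isClosed_le ?_ continuous_const
    exact ((hu.continuous.comp (continuous_subtype_val.add continuous_const)).sub
      (hu.continuous.comp continuous_subtype_val)).abs
  have hTu : ⋃ n, T n = univ := by
    refine eq_univ_of_forall fun y => mem_iUnion.2 ?_
    obtain ⟨c, hc⟩ := (hu (y : E)).isBigO_sub.bound
    obtain ⟨ε, hε, hball⟩ := Metric.eventually_nhds_iff.1 hc
    obtain ⟨n₁, hn₁⟩ := exists_nat_one_div_lt hε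
    obtain ⟨n₂, hn₂⟩ := exists_nat_ge c
    refine ⟨max n₁ n₂, fun v hv => ?_⟩
    have h1 : ‖v‖ < ε := by
      refine hv.trans_lt (lt_of_le_of_lt ?_ hn₁)
      gcongr
      exact le_max_left _ _
    have h2 := hball (y := (y : E) + v) (by simpa [dist_eq_norm] using h1)
    rw [add_sub_cancel_left, Real.norm_eq_abs] at h2
    refine h2.trans ?_
    gcongr
    refine hn₂.trans ?_
    exact_mod_cast le_max_right _ _
  obtain ⟨n, y₀, hy₀⟩ := nonempty_interior_of_iUnion_of_closed hTc hTu
  obtain ⟨r, hr, hrT⟩ := Metric.mem_nhds_iff.1 (mem_interior_iff_mem_nhds.1 hy₀)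
  exact ⟨y₀, y₀.2, r, hr, n, fun y hy hd => hrT (a := ⟨y, hy⟩) (mem_ball.2 hd)⟩

open Set Metric Filter Topology in
/-- If a density `h` controlled by `‖fderiv ℝ u‖ ^ 2` satisfies a Caccioppoli inequality on every
ball where it is already known to be locally integrable, then it is locally integrable. -/
theorem locallyIntegrableOn_of_caccioppoli_ball {E : Type*} [NormedAddCommGroup E]
    [NormedSpace ℝ E] [FiniteDimensional ℝ E] [MeasurableSpace E] [BorelSpace E] (μ : Measure E)
    [μ.IsAddHaarMeasure] {u h A : E → ℝ} {Ω : Set E} (hu : Differentiable ℝ u)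
    (hh : Measurable h) (h0 : ∀ p, 0 ≤ h p) (hΩ : IsOpen Ω) (hA : Continuous A)
    (hhA : ∀ p, h p ≤ A p * ‖fderiv ℝ u p‖ ^ 2)
    (hC : ∀ J : Set E, IsCompact J → J ⊆ Ω → ∀ L : ℝ, 0 ≤ L → ∃ C : NNReal, ∀ (x : E) (d c : ℝ),
      0 < d → d ≤ 1 → ball x d ⊆ J → LocallyIntegrableOn h (ball x d) μ →
      (∀ ξ ∈ ball x d, |u ξ - c| ≤ L * d) →
      ∫⁻ y in ball x (d / 2), ENNReal.ofReal (h y) ∂μ ≤ C * μ (ball x d)) :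
    LocallyIntegrableOn h Ω μ := by
  have : ProperSpace E := FiniteDimensional.proper ℝ E
  set G : Set E := {p | IntegrableAtFilter h (𝓝 p) μ} with hG
  have hGo : IsOpen G := by
    refine isOpen_iff_mem_nhds.2 fun p ⟨s, hs, hi⟩ => ?_
    filter_upwards [eventually_mem_nhds_iff.2 hs] with q hq using ⟨s, hq, hi⟩
  suffices hF : ¬ (Ω \ G).Nonempty by
    intro p hp
    have : p ∈ G := by
      by_contra hpG
      exact hF ⟨p, hp, hpG⟩
    exact IntegrableAtFilter.filter_mono nhdsWithin_le_nhds this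
  intro hne
  have hFl : IsLocallyClosed (Ω \ G) := hΩ.isLocallyClosed.inter hGo.isClosed_compl.isLocallyClosed
  obtain ⟨y₀, hy₀, r₁, hr₁, n, hn⟩ := exists_ball_lipschitz_at hu hFl hne
  obtain ⟨r₂, hr₂, hr₂Ω⟩ := Metric.isOpen_iff.1 hΩ y₀ hy₀.1
  obtain ⟨r, hr, hr₁', hr₂', hrn⟩ : ∃ r > 0, r ≤ r₁ ∧ r < r₂ ∧ r ≤ 1 / (n + 1 : ℝ) := by
    have hn0 : (0 : ℝ) < 1 / (n + 1 : ℝ) := by positivity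
    refine ⟨min r₁ (min (r₂ / 2) (1 / (n + 1 : ℝ))), by positivity, min_le_left _ _, ?_, ?_⟩
    · exact ((min_le_right _ _).trans (min_le_left _ _)).trans_lt (by linarith)
    · exact (min_le_right _ _).trans (min_le_right _ _)
  have hn1 : 1 / (n + 1 : ℝ) ≤ 1 := by
    rw [div_le_one (by positivity)]; linarith [(Nat.cast_nonneg n : (0 : ℝ) ≤ n)]
  have hJ : IsCompact (closedBall y₀ r) := isCompact_closedBall _ _
  have hJΩ : closedBall y₀ r ⊆ Ω := (closedBall_subset_ball hr₂').trans hr₂Ω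
  obtain ⟨C, hCJ⟩ := hC _ hJ hJΩ (3 * n) (by positivity)
  have hFm : MeasurableSet (Ω \ G) := hΩ.measurableSet.diff hGo.measurableSet
  set F := Ω \ G with hFdef
  have hoff : ∫⁻ y in ball y₀ (r / 4) \ F, ENNReal.ofReal (h y) ∂μ < ⊤ := by
    have hd : ∀ x ∈ ball y₀ (r / 4), infDist x F < r / 4 := fun x hx =>
      (infDist_le_dist_of_mem hy₀).trans_lt hx
    have hd0 : ∀ x ∈ ball y₀ (r / 4) \ F, 0 < infDist x F := by
      intro x hx
      refine (infDist_pos_iff_notMem_closure hne).1 fun hxF => ?_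
      have hxΩ : x ∈ Ω := hJΩ (closedBall_subset_closedBall (by linarith)
        (ball_subset_closedBall hx.1))
      have hxG : x ∉ G := closure_minimal (fun y hy => hy.2) hGo.isClosed_compl hxF
      exact hx.2 ⟨hxΩ, hxG⟩
    have hsub : ∀ x ∈ ball y₀ (r / 4) \ F, ball x (infDist x F) ⊆ closedBall y₀ r := by
      intro x hx ξ hξ
      have h1 := hd x hx.1
      have h2 := mem_ball.1 hx.1
      have h3 := mem_ball.1 hξ
      have h4 := dist_triangle ξ x y₀
      rw [mem_closedBall]; linarith
    have := measure_le_of_forall_ball μ (μ.withDensity fun y => ENNReal.ofReal (h y))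
      (S := ball y₀ (r / 4) \ F) (J := closedBall y₀ r) (d := fun x => infDist x F) (R := r / 4)
      (C := C) hd0 (fun x hx => (hd x hx.1).le) hsub ?_
    · rw [withDensity_apply _ (measurableSet_ball.diff hFm)] at this
      refine this.trans_lt ?_
      exact ENNReal.mul_lt_top ENNReal.coe_lt_top
        (ENNReal.mul_lt_top ENNReal.ofReal_lt_top hJ.measure_lt_top)
    · intro x hx
      rw [withDensity_apply _ measurableSet_ball]
      have h1 := hd x hx.1
      have h0' := hd0 x hx
      obtain ⟨y, hy, hxy⟩ := (infDist_lt_iff hne).1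
        (show infDist x F < 2 * infDist x F by linarith)
      refine hCJ x _ (u y) h0' (by linarith) (hsub x hx) ?_ fun ξ hξ => ?_
      · intro ξ hξ
        have hξG : ξ ∈ G := by
          by_contra hξG
          have : ξ ∈ F := ⟨hJΩ (hsub x hx hξ), hξG⟩
          have h5 := infDist_le_dist_of_mem (x := x) this
          rw [mem_ball, dist_comm] at hξ
          linarith
        exact IntegrableAtFilter.filter_mono nhdsWithin_le_nhds hξG
      · have h6 : dist y y₀ < r₁ := by
          have := dist_triangle y x y₀
          have h2 := mem_ball.1 hx.1
          rw [dist_comm y x] at this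
          linarith
        have h7 : ‖ξ - y‖ < 3 * infDist x F := by
          rw [← dist_eq_norm]
          have := dist_triangle ξ x y
          have h2 := mem_ball.1 hξ
          linarith
        have h8 := hn y hy h6 (ξ - y) (by linarith)
        rw [add_sub_cancel] at h8
        refine h8.trans ?_
        calc (n : ℝ) * ‖ξ - y‖ ≤ n * (3 * infDist x F) := by gcongr
          _ = _ := by ring
  obtain ⟨M, hM⟩ := hJ.exists_bound_of_continuousOn hA.continuousOn
  have hon : ∫⁻ y in ball y₀ (r / 4) ∩ F, ENNReal.ofReal (h y) ∂μ < ⊤ := by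
    calc ∫⁻ y in ball y₀ (r / 4) ∩ F, ENNReal.ofReal (h y) ∂μ
        ≤ ∫⁻ y in ball y₀ (r / 4) ∩ F, ENNReal.ofReal (M * n ^ 2) ∂μ := by
          refine setLIntegral_mono' (measurableSet_ball.inter hFm) fun y hy => ?_
          refine ENNReal.ofReal_le_ofReal ((hhA y).trans ?_)
          have hyr := mem_ball.1 hy.1
          have hyJ : y ∈ closedBall y₀ r := by rw [mem_closedBall]; linarith
          have hM0 := (norm_nonneg _).trans (hM y hyJ)
          have hfd : ‖fderiv ℝ u y‖ ≤ n := by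
            refine (hu y).hasFDerivAt.le_of_lip' (Nat.cast_nonneg n) ?_
            filter_upwards [closedBall_mem_nhds y
              (show (0 : ℝ) < 1 / (n + 1 : ℝ) by positivity)] with ξ hξ
            rw [mem_closedBall, dist_eq_norm] at hξ
            have := hn y hy.2 (by linarith) (ξ - y) hξ
            rwa [add_sub_cancel] at this
          gcongr
          exact (le_abs_self _).trans (hM y hyJ)
      _ = ENNReal.ofReal (M * n ^ 2) * μ (ball y₀ (r / 4) ∩ F) := setLIntegral_const _ _
      _ < ⊤ := ENNReal.mul_lt_top ENNReal.ofReal_lt_top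
          ((measure_mono inter_subset_left).trans_lt measure_ball_lt_top)
  refine hy₀.2 ⟨ball y₀ (r / 4), ball_mem_nhds _ (by positivity), hh.aestronglyMeasurable, ?_⟩
  rw [hasFiniteIntegral_iff_ofReal (.of_forall h0),
    ← lintegral_inter_add_sdiff _ (ball y₀ (r / 4)) hFm]
  exact ENNReal.add_lt_top.2 ⟨hon, hoff⟩

theorem XgradSq_nonneg (α : ℝ) (u : Pt m k → ℝ) (p : Pt m k) : 0 ≤ XgradSq α u p := by
  rw [XgradSq_eq_sum]
  positivity

theorem measurable_XgradSq {α : ℝ} (hα : 0 < α) (u : Pt m k → ℝ) : Measurable (XgradSq α u) := by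
  rw [funext (XgradSq_eq_sum α u)]
  exact Finset.measurable_sum _ fun i _ => (measurable_xderiv hα u i).pow_const 2

theorem XgradSq_le (α : ℝ) (u : Pt m k → ℝ) (p : Pt m k) :
    XgradSq α u p ≤ (∑ i : Fin m ⊕ Fin k, (xwt α i p * ‖(xdir i : Pt m k)‖) ^ 2)
      * ‖fderiv ℝ u p‖ ^ 2 := by
  rw [XgradSq_eq_sum, Finset.sum_mul]
  refine Finset.sum_le_sum fun i _ => ?_
  have h := (fderiv ℝ u p).le_opNorm (xdir i)
  rw [Real.norm_eq_abs] at h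
  rw [← mul_pow, ← sq_abs, xderiv, abs_mul, abs_of_nonneg (xwt_nonneg α i p), mul_assoc]
  have h0 := xwt_nonneg α i p
  gcongr
  rwa [mul_comm]

theorem XgradSq_eq_zero_of_notMem_tsupport (α : ℝ) {η : Pt m k → ℝ} {p : Pt m k}
    (hp : p ∉ tsupport η) : XgradSq α η p = 0 := by
  have h := XgradSq_le α η p
  rw [image_eq_zero_of_notMem_tsupport fun h => hp (tsupport_fderiv_subset ℝ h)] at h
  exact le_antisymm (by simpa using h) (XgradSq_nonneg α η p)

open Metric Set in
theorem exists_cutoff_ball (E : Type*) [NormedAddCommGroup E] [NormedSpace ℝ E]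
    [FiniteDimensional ℝ E] : ∃ D : ℝ, ∀ (x : E) (d : ℝ), 0 < d → ∃ η : E → ℝ,
      ContDiff ℝ (⊤ : ℕ∞) η ∧ HasCompactSupport η ∧ tsupport η ⊆ ball x d ∧
      (∀ p, 0 ≤ η p ∧ η p ≤ 1) ∧ (∀ p ∈ ball x (d / 2), η p = 1) ∧
      ∀ p, ‖fderiv ℝ η p‖ ≤ D / d := by
  have : ProperSpace E := FiniteDimensional.proper ℝ E
  let f : ContDiffBump (0 : E) := ⟨1 / 2, 3 / 4, by norm_num, by norm_num⟩
  have hf : ContDiff ℝ (⊤ : ℕ∞) f := f.contDiff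
  obtain ⟨D, hD⟩ := (f.hasCompactSupport.fderiv (𝕜 := ℝ)).exists_bound_of_continuous
    (hf.continuous_fderiv (by simp))
  refine ⟨D, fun x d hd => ⟨fun p => f (d⁻¹ • (p - x)), ?_⟩⟩
  have hn : ∀ p : E, ‖d⁻¹ • (p - x)‖ = dist p x / d := fun p => by
    rw [norm_smul, norm_inv, Real.norm_of_nonneg hd.le, dist_eq_norm, inv_mul_eq_div]
  have hsupp : Function.support (fun p => f (d⁻¹ • (p - x))) ⊆ closedBall x (3 / 4 * d) := by
    intro p hp
    have h1 : d⁻¹ • (p - x) ∈ Function.support f := hp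
    rw [f.support_eq, mem_ball_zero_iff, hn, div_lt_iff₀ hd] at h1
    exact mem_closedBall.2 h1.le
  have htsupp : tsupport (fun p => f (d⁻¹ • (p - x))) ⊆ closedBall x (3 / 4 * d) :=
    closure_minimal hsupp isClosed_closedBall
  refine ⟨hf.comp (contDiff_const.smul (contDiff_id.sub contDiff_const)),
    (isCompact_closedBall _ _).of_isClosed_subset (isClosed_tsupport _) htsupp,
    htsupp.trans (closedBall_subset_ball (by linarith)), fun p => ⟨f.nonneg, f.le_one⟩, ?_, ?_⟩
  · intro p hp
    refine f.one_of_mem_closedBall ?_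
    rw [mem_closedBall_zero_iff, hn, div_le_iff₀ hd]
    have := mem_ball.1 hp
    change dist p x ≤ 1 / 2 * d
    linarith
  · intro p
    have h1 : HasFDerivAt (fun p : E => d⁻¹ • (p - x)) (d⁻¹ • ContinuousLinearMap.id ℝ E) p :=
      ((hasFDerivAt_id p).sub_const x).const_smul d⁻¹
    have h2 := ((hf.differentiable (by simp) _).hasFDerivAt.comp p h1).fderiv
    rw [show (fun p => f (d⁻¹ • (p - x))) = f ∘ fun p : E => d⁻¹ • (p - x) from rfl, h2,
      ContinuousLinearMap.comp_smul, ContinuousLinearMap.comp_id, norm_smul, norm_inv,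
      Real.norm_of_nonneg hd.le, inv_mul_eq_div]
    gcongr
    exact hD _

open Metric Set in
theorem locallyIntegrableOn_XgradSq {α : ℝ} (hα : 0 < α) {u κ : Pt m k → ℝ} {Ω : Set (Pt m k)}
    (hu : Differentiable ℝ u) (hκ : ContinuousOn κ Ω) (hκ0 : ∀ p ∈ Ω, 0 ≤ κ p)
    (hT : ∀ w : Pt m k → ℝ, ContDiff ℝ (⊤ : ℕ∞) w → HasCompactSupport w → tsupport w ⊆ Ω →
      |∫ p, ∑ i, xderiv α u i p * xderiv α w i p| ≤ ∫ p, κ p * |u p| * |w p|)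
    (hΩ : IsOpen Ω) : LocallyIntegrableOn (XgradSq α u) Ω := by
  set A : Pt m k → ℝ := fun p => ∑ i : Fin m ⊕ Fin k, (xwt α i p * ‖(xdir i : Pt m k)‖) ^ 2
  have hA : Continuous A :=
    continuous_finsetSum _ fun i _ => ((continuous_xwt hα i).mul continuous_const).pow 2
  have hA0 : ∀ p, 0 ≤ A p := fun p => by positivity
  obtain ⟨D, hD⟩ := exists_cutoff_ball (Pt m k)
  refine locallyIntegrableOn_of_caccioppoli_ball volume hu (measurable_XgradSq hα u)
    (XgradSq_nonneg α u) hΩ hA (XgradSq_le α u) fun J hJ hJΩ L hL => ?_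
  obtain ⟨K₁, hK₁⟩ := hJ.exists_bound_of_continuousOn (hκ.mono hJΩ)
  obtain ⟨K₂, hK₂⟩ := hJ.exists_bound_of_continuousOn hu.continuous.continuousOn
  obtain ⟨K₃, hK₃⟩ := hJ.exists_bound_of_continuousOn hA.continuousOn
  refine ⟨(2 * (K₁ * K₂ * L) + 4 * (L ^ 2 * (K₃ * D ^ 2))).toNNReal,
    fun x d c hd hd1 hxJ hX hc => ?_⟩
  obtain ⟨η, hη, hηc, hηs, hη01, hη1, hηD⟩ := hD x d hd
  obtain ⟨hi, hle⟩ := caccioppoli_cutoff hα hu hκ hκ0 hT isOpen_ball (hxJ.trans hJΩ) hX hη hηc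
    hηs c
  set B : ℝ := 2 * (K₁ * K₂ * L) + 4 * (L ^ 2 * (K₃ * D ^ 2))
  have hη0 : ∀ p ∉ ball x d, η p = 0 := fun p hp =>
    image_eq_zero_of_notMem_tsupport fun h => hp (hηs h)
  have hXη0 : ∀ p ∉ ball x d, XgradSq α η p = 0 := fun p hp =>
    XgradSq_eq_zero_of_notMem_tsupport α fun h => hp (hηs h)
  have hbd : ∫ p, (2 * (κ p * |u p| * (η p ^ 2 * |u p - c|)) + 4 * ((u p - c) ^ 2 * XgradSq α η p))
      ≤ ∫ p, (ball x d).indicator (fun _ => B) p := by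
    refine integral_mono_of_nonneg (.of_forall fun p => ?_) ?_ (.of_forall fun p => ?_)
    · by_cases hp : p ∈ ball x d
      · have h1 := hκ0 p (hJΩ (hxJ hp))
        have h2 := XgradSq_nonneg α η p
        dsimp only [Pi.zero_apply]
        positivity
      · simp [hη0 p hp, hXη0 p hp]
    · exact (integrable_indicator_iff measurableSet_ball).2
        (integrableOn_const measure_ball_lt_top.ne)
    · by_cases hp : p ∈ ball x d
      · have h1 := hκ0 p (hJΩ (hxJ hp))
        have h2 := hK₁ p (hxJ hp)
        have h3 := hK₂ p (hxJ hp)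
        have h4 := hK₃ p (hxJ hp)
        rw [Real.norm_of_nonneg h1] at h2
        rw [Real.norm_eq_abs] at h3
        rw [Real.norm_of_nonneg (hA0 p)] at h4
        have h5 : |u p - c| ≤ L := (hc p hp).trans (mul_le_of_le_one_right hL hd1)
        have h6 : η p ^ 2 ≤ 1 := pow_le_one₀ (hη01 p).1 (hη01 p).2
        have h7 : (u p - c) ^ 2 ≤ (L * d) ^ 2 := by
          rw [← sq_abs]
          have := hc p hp
          gcongr
        have h8 : XgradSq α η p ≤ K₃ * (D / d) ^ 2 := by
          refine (XgradSq_le α η p).trans ?_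
          have := hηD p
          have := (hA0 p).trans h4
          change A p * _ ≤ _
          gcongr
        have h9 : (u p - c) ^ 2 * XgradSq α η p ≤ L ^ 2 * (K₃ * D ^ 2) := by
          calc _ ≤ (L * d) ^ 2 * (K₃ * (D / d) ^ 2) := by
                gcongr
                exact XgradSq_nonneg α η p
            _ = _ := by field_simp
        have h10 : κ p * |u p| * (η p ^ 2 * |u p - c|) ≤ K₁ * K₂ * (1 * L) := by
          have := h1.trans h2
          have := (abs_nonneg _).trans h3
          gcongr
        rw [indicator_of_mem hp]
        simp only [B]
        linarith
      · simp [hη0 p hp, hXη0 p hp, hp]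
  calc ∫⁻ y in ball x (d / 2), ENNReal.ofReal (XgradSq α u y)
      ≤ ∫⁻ y, ENNReal.ofReal (η y ^ 2 * XgradSq α u y) := by
        rw [← lintegral_indicator measurableSet_ball]
        refine lintegral_mono fun y => ?_
        by_cases hy : y ∈ ball x (d / 2)
        · simp [hy, hη1 y hy]
        · simp [hy]
    _ = ENNReal.ofReal (∫ y, η y ^ 2 * XgradSq α u y) :=
        (ofReal_integral_eq_lintegral_ofReal hi (.of_forall fun y =>
          mul_nonneg (sq_nonneg _) (XgradSq_nonneg α u y))).symm
    _ ≤ ENNReal.ofReal (volume.real (ball x d) * B) := by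
        refine ENNReal.ofReal_le_ofReal ((hle.trans hbd).trans_eq ?_)
        rw [integral_indicator measurableSet_ball, setIntegral_const, smul_eq_mul]
    _ = _ := by
        rw [ENNReal.ofReal_mul measureReal_nonneg, mul_comm, measureReal_def,
          ENNReal.ofReal_toReal measure_ball_lt_top.ne]
        rfl

theorem rho_nonneg (α : ℝ) (p : Pt m k) : 0 ≤ rho α p := by
  unfold rho; positivity

theorem continuous_rho {α : ℝ} (hα : 0 < α) : Continuous (rho α : Pt m k → ℝ) := by
  unfold rho
  refine Continuous.rpow_const ?_ fun _ => Or.inr (by positivity)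
  refine Continuous.add (continuous_fst.norm.rpow_const fun _ => Or.inr (by positivity)) ?_
  exact continuous_const.mul (continuous_snd.norm.pow 2)

theorem rho_dil {α l : ℝ} (hα : 0 < α) (hl : 0 < l) (p : Pt m k) :
    rho α (dil α l p) = l * rho α p := by
  have h1 : ‖(dil α l p).1‖ ^ (2*(α+1)) + (α+1)^2 * ‖(dil α l p).2‖^2
      = l ^ (2*(α+1)) * (‖p.1‖ ^ (2*(α+1)) + (α+1)^2 * ‖p.2‖^2) := by
    have h2 : (l ^ (α+1)) ^ 2 = l ^ (2*(α+1)) := by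
      rw [← Real.rpow_natCast, ← Real.rpow_mul hl.le, mul_comm]; norm_num
    simp only [dil, norm_smul, Real.norm_of_nonneg hl.le,
      Real.norm_of_nonneg (Real.rpow_nonneg hl.le _)]
    rw [Real.mul_rpow hl.le (norm_nonneg _), mul_pow, h2]
    ring
  rw [rho, h1, Real.mul_rpow (by positivity) (by positivity), ← Real.rpow_mul hl.le,
    mul_one_div_cancel (by positivity), Real.rpow_one, rho]

theorem rpow_rho {α : ℝ} (hα : 0 < α) (p : Pt m k) :
    rho α p ^ (2*(α+1)) = ‖p.1‖ ^ (2*(α+1)) + (α+1)^2 * ‖p.2‖^2 := by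
  rw [rho, ← Real.rpow_mul (by positivity), one_div_mul_cancel (by positivity), Real.rpow_one]

theorem isCompact_setOf_rho_le {α : ℝ} (hα : 0 < α) (r : ℝ) :
    IsCompact {p : Pt m k | rho α p ≤ r} := by
  refine Metric.isCompact_of_isClosed_isBounded
    (isClosed_le (continuous_rho hα) continuous_const) ?_
  refine isBounded_iff_forall_norm_le.2 ⟨max r (r ^ (α + 1)), fun p hp => ?_⟩
  have hp' : rho α p ≤ r := hp
  have hr : 0 ≤ r := (rho_nonneg α p).trans hp'
  have h1 : ‖p.1‖ ^ (2*(α+1)) + (α+1)^2 * ‖p.2‖^2 ≤ r ^ (2*(α+1)) := by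
    rw [← rpow_rho hα]
    exact Real.rpow_le_rpow (rho_nonneg α p) hp' (by positivity)
  have h2 : 0 ≤ (α+1)^2 * ‖p.2‖^2 := by positivity
  have h3 : 0 ≤ ‖p.1‖ ^ (2*(α+1)) := by positivity
  refine max_le_max ?_ ?_
  · exact (Real.rpow_le_rpow_iff (norm_nonneg _) hr (by positivity : 0 < 2*(α+1))).1 (by linarith)
  · have h4 : r ^ (2*(α+1)) = (r ^ (α+1)) ^ 2 := by
      rw [← Real.rpow_natCast, ← Real.rpow_mul hr, mul_comm]; norm_num
    refine abs_le_of_sq_le_sq' ?_ (by positivity) |>.2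
    have h5 : 1 ≤ (α + 1) ^ 2 := one_le_pow₀ (by linarith)
    nlinarith [mul_nonneg (sub_nonneg.2 h5) (sq_nonneg ‖p.2‖)]

theorem contDiff_dil (α l : ℝ) : ContDiff ℝ (⊤ : ℕ∞) (dil α l : Pt m k → Pt m k) :=
  (contDiff_fst.const_smul l).prodMk (contDiff_snd.const_smul (l ^ (α+1)))

theorem hasFDerivAt_dil (α l : ℝ) (p : Pt m k) : HasFDerivAt (dil α l : Pt m k → Pt m k)
    ((l • ContinuousLinearMap.fst ℝ _ _).prod ((l ^ (α+1)) • ContinuousLinearMap.snd ℝ _ _)) p :=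
  (hasFDerivAt_fst.const_smul l).prodMk (hasFDerivAt_snd.const_smul (l ^ (α+1)))

theorem xderiv_comp_dil {α l : ℝ} (hl : 0 < l) {η : Pt m k → ℝ} (hη : Differentiable ℝ η)
    (i : Fin m ⊕ Fin k) (p : Pt m k) :
    xderiv α (η ∘ dil α l) i p = l * xderiv α η i (dil α l p) := by
  rw [xderiv, ((hη _).hasFDerivAt.comp p (hasFDerivAt_dil α l p)).fderiv, xderiv]
  rcases i with i | j
  · have : ((l • EuclideanSpace.single i (1:ℝ), (l ^ (α+1)) • 0) : Pt m k) = l • ez i := by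
      simp [ez]
    simp only [xwt, xdir, Sum.elim_inl, ContinuousLinearMap.comp_apply,
      ContinuousLinearMap.prod_apply, smul_apply, ContinuousLinearMap.coe_fst',
      ContinuousLinearMap.coe_snd', ez]
    rw [this, map_smul, smul_eq_mul, ez]
    ring
  · have : ((l • 0, (l ^ (α+1)) • EuclideanSpace.single j (1:ℝ)) : Pt m k)
        = (l ^ (α+1)) • et j := by
      simp [et]
    simp only [xwt, xdir, Sum.elim_inr, ContinuousLinearMap.comp_apply,
      ContinuousLinearMap.prod_apply, smul_apply, ContinuousLinearMap.coe_fst',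
      ContinuousLinearMap.coe_snd', et]
    rw [this, map_smul, smul_eq_mul, et, dil, norm_smul, Real.norm_of_nonneg hl.le,
      Real.mul_rpow hl.le (norm_nonneg _), Real.rpow_add hl, Real.rpow_one]
    ring

theorem XgradSq_comp_dil {α l : ℝ} (hl : 0 < l) {η : Pt m k → ℝ} (hη : Differentiable ℝ η)
    (p : Pt m k) : XgradSq α (η ∘ dil α l) p = l ^ 2 * XgradSq α η (dil α l p) := by
  simp only [XgradSq_eq_sum, xderiv_comp_dil hl hη, mul_pow, Finset.mul_sum]

open scoped Manifold in
/-- Cutoff functions adapted to gauge annuli. -/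
theorem exists_cutoff_rho (m k : ℕ) {α : ℝ} (hα : 0 < α) : ∃ D : ℝ, 0 ≤ D ∧ ∀ r : ℝ, 0 < r →
    ∃ η : Pt m k → ℝ, ContDiff ℝ (⊤ : ℕ∞) η ∧ HasCompactSupport η ∧
      (∀ p ∈ tsupport η, r / 2 ≤ rho α p ∧ rho α p ≤ 3 * r) ∧
      (∀ p, 0 ≤ η p ∧ η p ≤ 1) ∧ (∀ p, r < rho α p → rho α p < 2 * r → η p = 1) ∧
      ∀ p, XgradSq α η p ≤ D / r ^ 2 := by
  have hρ := continuous_rho (m := m) (k := k) hα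
  obtain ⟨f, hf1, hf0, hf⟩ := exists_contMDiffMap_one_nhds_of_subset_interior
    𝓘(ℝ, Pt m k) (n := ⊤) (s := {p : Pt m k | 1 ≤ rho α p ∧ rho α p ≤ 2})
    (t := {p : Pt m k | 1 / 2 ≤ rho α p ∧ rho α p ≤ 3})
    ((isClosed_le continuous_const hρ).inter (isClosed_le hρ continuous_const)) (by
      refine Set.Subset.trans ?_ (interior_maximal (t := {p | 1 / 2 < rho α p ∧ rho α p < 3})
        (fun p hp => ⟨hp.1.le, hp.2.le⟩)
        ((isOpen_lt continuous_const hρ).inter (isOpen_lt hρ continuous_const)))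
      exact fun p hp => ⟨by linarith [hp.1], by linarith [hp.2]⟩)
  have hfs : ContDiff ℝ (⊤ : ℕ∞) f := f.contMDiff.contDiff
  have hsupp : ∀ p, f p ≠ 0 → 1 / 2 ≤ rho α p ∧ rho α p ≤ 3 := fun p hp => by
    by_contra h
    exact hp (hf0 p h)
  have hfc : HasCompactSupport f :=
    HasCompactSupport.intro (isCompact_setOf_rho_le hα 3) fun p hp => by
      by_contra h
      exact hp (hsupp p h).2
  have hX : Continuous (XgradSq α f) := by
    rw [funext (XgradSq_eq_sum α f)]
    exact continuous_finsetSum _ fun i _ => (continuous_xderiv hα hfs i).pow 2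
  obtain ⟨D, hD⟩ := HasCompactSupport.exists_bound_of_continuous
    (HasCompactSupport.intro hfc fun p hp => XgradSq_eq_zero_of_notMem_tsupport α hp) hX
  refine ⟨D, (norm_nonneg _).trans (hD 0), fun r hr => ⟨f ∘ dil α r⁻¹, ?_⟩⟩
  have hr' : 0 < r⁻¹ := inv_pos.2 hr
  have hρr : ∀ p : Pt m k, rho α (dil α r⁻¹ p) = rho α p / r := fun p => by
    rw [rho_dil hα hr', inv_mul_eq_div]
  have hts : ∀ p ∈ tsupport (f ∘ dil α r⁻¹), r / 2 ≤ rho α p ∧ rho α p ≤ 3 * r := by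
    refine closure_minimal (t := {p | r / 2 ≤ rho α p ∧ rho α p ≤ 3 * r}) (fun p hp => ?_)
      ((isClosed_le continuous_const hρ).inter (isClosed_le hρ continuous_const))
    have h := hsupp _ hp
    rw [hρr, le_div_iff₀ hr, div_le_iff₀ hr] at h
    exact ⟨by linarith [h.1], h.2⟩
  refine ⟨hfs.comp (contDiff_dil α _), ?_, hts, fun p => hf _, fun p h1 h2 => ?_, fun p => ?_⟩
  · exact (isCompact_setOf_rho_le hα (3 * r)).of_isClosed_subset (isClosed_tsupport _)
      fun p hp => (hts p hp).2
  · refine hf1.self_of_nhdsSet _ ?_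
    rw [Set.mem_ofPred_eq, hρr, le_div_iff₀ hr, div_le_iff₀ hr]
    exact ⟨by linarith, h2.le⟩
  · rw [XgradSq_comp_dil hr' (hfs.differentiable (by simp)), inv_pow, inv_mul_eq_div]
    gcongr
    exact (le_abs_self _).trans (hD _)

/-- The weak formulation, tested against functions supported away from the origin, with the
potential replaced by its bound. -/
theorem abs_integral_xderiv_mul_le {α R C₀ δ : ℝ} {u V : Pt m k → ℝ}
    (hu : Differentiable ℝ u)
    (hV : ∀ p ∈ (gball α R : Set (Pt m k)), |V p| ≤ C₀ * rho α p ^ (δ - 2))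
    (hκ : ContinuousOn (fun p : Pt m k => C₀ * rho α p ^ (δ - 2)) {p | 0 < rho α p ∧ rho α p < R})
    (hweak : ∀ w : Pt m k → ℝ, ContDiff ℝ (⊤ : ℕ∞) w → HasCompactSupport w →
      tsupport w ⊆ (gball α R : Set (Pt m k)) →
      (∫ p in (gball α R : Set (Pt m k)),
          ((∑ i : Fin m, fderiv ℝ u p (ez i) * fderiv ℝ w p (ez i))
            + ‖p.1‖ ^ (2*α) *
              (∑ j : Fin k, fderiv ℝ u p (et j) * fderiv ℝ w p (et j))))
        = - ∫ p in (gball α R : Set (Pt m k)), V p * u p * w p)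
    {w : Pt m k → ℝ} (hw : ContDiff ℝ (⊤ : ℕ∞) w) (hwc : HasCompactSupport w)
    (hwΩ : tsupport w ⊆ {p | 0 < rho α p ∧ rho α p < R}) :
    |∫ p, ∑ i, xderiv α u i p * xderiv α w i p|
      ≤ ∫ p, C₀ * rho α p ^ (δ - 2) * |u p| * |w p| := by
  have hwR : tsupport w ⊆ gball α R := fun p hp => (hwΩ hp).2
  have hw0 : ∀ p ∉ tsupport w, w p = 0 := fun p hp => image_eq_zero_of_notMem_tsupport hp
  have h := hweak w hw hwc hwR
  simp only [← sum_xderiv_mul] at h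
  rw [setIntegral_eq_integral_of_forall_compl_eq_zero,
    setIntegral_eq_integral_of_forall_compl_eq_zero] at h
  · rw [h, abs_neg, ← Real.norm_eq_abs]
    refine norm_integral_le_of_norm_le ?_ (.of_forall fun p => ?_)
    · rw [← integrableOn_iff_integrable_of_support_subset (s := tsupport w)]
      · exact (((hκ.mono hwΩ).mul hu.continuous.abs.continuousOn).mul
          hw.continuous.abs.continuousOn).integrableOn_compact hwc
      · intro p hp
        by_contra h
        exact hp (by simp [hw0 p h])
    · by_cases hp : p ∈ tsupport w
      · rw [norm_mul, norm_mul, Real.norm_eq_abs, Real.norm_eq_abs, Real.norm_eq_abs]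
        gcongr
        exact hV p (hwR hp)
      · simp [hw0 p hp]
  · intro p hp
    simp [hw0 p fun h => hp (hwR h)]
  · intro p hp
    refine Finset.sum_eq_zero fun i _ => ?_
    have : xderiv α w i p = 0 := by
      by_contra h
      exact hp (hwR (support_xderiv_subset α w i h))
    simp [this]

theorem caccioppoli_estimate (m k : ℕ) (α R C₀ δ : ℝ) (hα : 0 < α)
    (hC₀ : 1 < C₀) (hδ0 : 0 < δ) (hδ2 : δ ≤ 2) (hR : 0 < R) :
    ∃ C > 0, ∀ u V : Pt m k → ℝ, Differentiable ℝ u →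
      (∀ p ∈ (gball α R : Set (Pt m k)), |V p| ≤ C₀ * rho α p ^ (δ - 2)) →
      (∀ w : Pt m k → ℝ, ContDiff ℝ (⊤ : ℕ∞) w → HasCompactSupport w →
        tsupport w ⊆ (gball α R : Set (Pt m k)) →
        (∫ p in (gball α R : Set (Pt m k)),
            ((∑ i : Fin m, fderiv ℝ u p (ez i) * fderiv ℝ w p (ez i))
              + ‖p.1‖ ^ (2*α) *
                (∑ j : Fin k, fderiv ℝ u p (et j) * fderiv ℝ w p (et j))))
          = - ∫ p in (gball α R : Set (Pt m k)), V p * u p * w p) →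
      ∀ r₀ : ℝ, 0 < r₀ → 4*r₀ < R →
        (∫⁻ p in ({p : Pt m k | r₀ < rho α p ∧ rho α p < 2*r₀}),
            ENNReal.ofReal (XgradSq α u p))
          ≤ ENNReal.ofReal (C / r₀^2) *
              ∫⁻ p in (gball α (4*r₀) : Set (Pt m k)), ENNReal.ofReal ((u p)^2) := by
  obtain ⟨D, hD0, hD⟩ := exists_cutoff_rho m k hα
  have hC₀' : 0 < C₀ := one_pos.trans hC₀
  refine ⟨8 * C₀ * R ^ δ + 4 * D, by positivity, fun u V hu hV hweak r hr hrR => ?_⟩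
  have hρ := continuous_rho (m := m) (k := k) hα
  set Ω : Set (Pt m k) := {p | 0 < rho α p ∧ rho α p < R}
  have hΩ : IsOpen Ω :=
    (isOpen_lt continuous_const hρ).inter (isOpen_lt hρ continuous_const)
  set κ : Pt m k → ℝ := fun p => C₀ * rho α p ^ (δ - 2) with hκdef
  have hκ0 : ∀ p, 0 ≤ κ p := fun p =>
    mul_nonneg hC₀'.le (Real.rpow_nonneg (rho_nonneg α p) _)
  have hκ : ContinuousOn κ Ω :=
    continuousOn_const.mul (hρ.continuousOn.rpow_const fun p hp => Or.inl hp.1.ne')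
  have hT := fun w => abs_integral_xderiv_mul_le (w := w) hu hV hκ hweak
  have hX := locallyIntegrableOn_XgradSq hα hu hκ (fun p _ => hκ0 p) hT hΩ
  obtain ⟨η, hη, hηc, hηs, hη01, hη1, hηD⟩ := hD r hr
  have hηΩ : tsupport η ⊆ Ω := fun p hp =>
    ⟨by linarith [(hηs p hp).1], by linarith [(hηs p hp).2]⟩
  obtain ⟨hi, hle⟩ := caccioppoli_cutoff hα hu hκ (fun p _ => hκ0 p) hT hΩ subset_rfl hX hη hηc
    hηΩ 0
  set B : ℝ := (8 * C₀ * R ^ δ + 4 * D) / r ^ 2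
  have hgm : MeasurableSet (gball α (4 * r) : Set (Pt m k)) :=
    (isOpen_lt hρ continuous_const).measurableSet
  have hiu : IntegrableOn (fun p => u p ^ 2) (gball α (4 * r)) :=
    ((hu.continuous.pow 2).continuousOn.integrableOn_compact
      (isCompact_setOf_rho_le hα (4 * r))).mono_set fun p (hp : rho α p < 4 * r) => hp.le
  have hκr : ∀ p ∈ tsupport η, κ p ≤ 4 * C₀ * R ^ δ / r ^ 2 := by
    intro p hp
    have h1 : rho α p ^ (δ - 2) ≤ (r / 2) ^ (δ - 2) :=
      Real.rpow_le_rpow_of_nonpos (by positivity) (hηs p hp).1 (by linarith)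
    have h2 : (r / 2) ^ (δ - 2) = (r / 2) ^ δ / (r / 2) ^ 2 := by
      rw [Real.rpow_sub (by positivity), Real.rpow_two]
    have h3 : (r / 2) ^ δ ≤ R ^ δ := Real.rpow_le_rpow (by positivity) (by linarith) hδ0.le
    calc κ p ≤ C₀ * (R ^ δ / (r / 2) ^ 2) := by
          rw [h2] at h1
          refine mul_le_mul_of_nonneg_left (h1.trans ?_) hC₀'.le
          gcongr
      _ = _ := by field_simp; ring
  have hbd : ∫ p, (2 * (κ p * |u p| * (η p ^ 2 * |u p - 0|)) + 4 * ((u p - 0) ^ 2 * XgradSq α η p))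
      ≤ ∫ p, (gball α (4 * r)).indicator (fun p => B * u p ^ 2) p := by
    refine integral_mono_of_nonneg (.of_forall fun p => ?_)
      ((integrable_indicator_iff hgm).2 (hiu.const_mul B)) (.of_forall fun p => ?_)
    · have h1 := hκ0 p
      have h2 := XgradSq_nonneg α η p
      dsimp only [Pi.zero_apply]
      positivity
    · by_cases hp : p ∈ tsupport η
      · have hpg : p ∈ (gball α (4 * r) : Set (Pt m k)) := by
          change rho α p < 4 * r
          linarith [(hηs p hp).2]
        rw [Set.indicator_of_mem hpg]
        have h1 : η p ^ 2 ≤ 1 := pow_le_one₀ (hη01 p).1 (hη01 p).2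
        have h2 : κ p * |u p| * (η p ^ 2 * |u p|) ≤ 4 * C₀ * R ^ δ / r ^ 2 * u p ^ 2 := by
          calc κ p * |u p| * (η p ^ 2 * |u p|) = κ p * η p ^ 2 * |u p| ^ 2 := by ring
            _ ≤ 4 * C₀ * R ^ δ / r ^ 2 * 1 * |u p| ^ 2 := by
              gcongr
              exact hκr p hp
            _ = _ := by rw [sq_abs, mul_one]
        have h3 : u p ^ 2 * XgradSq α η p ≤ u p ^ 2 * (D / r ^ 2) := by
          gcongr
          exact hηD p
        calc _ = 2 * (κ p * |u p| * (η p ^ 2 * |u p|)) + 4 * (u p ^ 2 * XgradSq α η p) := by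
              simp only [sub_zero]
          _ ≤ 2 * (4 * C₀ * R ^ δ / r ^ 2 * u p ^ 2) + 4 * (u p ^ 2 * (D / r ^ 2)) := by gcongr
          _ = B * u p ^ 2 := by simp only [B]; ring
      · have h0 : 0 ≤ (gball α (4 * r)).indicator (fun p => B * u p ^ 2) p :=
          Set.indicator_nonneg (fun p _ => by positivity) p
        simpa [XgradSq_eq_zero_of_notMem_tsupport α hp, image_eq_zero_of_notMem_tsupport hp]
          using h0
  have hAm : MeasurableSet {p : Pt m k | r < rho α p ∧ rho α p < 2 * r} :=
    ((isOpen_lt continuous_const hρ).inter (isOpen_lt hρ continuous_const)).measurableSet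
  calc ∫⁻ p in {p : Pt m k | r < rho α p ∧ rho α p < 2 * r}, ENNReal.ofReal (XgradSq α u p)
      ≤ ∫⁻ p, ENNReal.ofReal (η p ^ 2 * XgradSq α u p) := by
        rw [← lintegral_indicator hAm]
        refine lintegral_mono fun p => ?_
        by_cases hp : r < rho α p ∧ rho α p < 2 * r
        · simp [hp, hη1 p hp.1 hp.2]
        · simp [hp]
    _ = ENNReal.ofReal (∫ p, η p ^ 2 * XgradSq α u p) :=
        (ofReal_integral_eq_lintegral_ofReal hi (.of_forall fun p =>
          mul_nonneg (sq_nonneg _) (XgradSq_nonneg α u p))).symm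
    _ ≤ ENNReal.ofReal (B * ∫ p in gball α (4 * r), u p ^ 2) := by
        refine ENNReal.ofReal_le_ofReal ((hle.trans hbd).trans_eq ?_)
        rw [integral_indicator hgm, integral_const_mul]
    _ = _ := by
        rw [ENNReal.ofReal_mul (by positivity),
          ofReal_integral_eq_lintegral_ofReal hiu (.of_forall fun p => sq_nonneg _)]
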